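/- For every integer d ≥ 2, every interval I ⊂ ℝ and every integer H ≥ 2, one has |#(𝔸_d(H) ∩ I)/H^{d+1} − (1/(2·ζ(d+1)))·∫_I ρ_d(x) dx| ≤ K₁(d)·(log H)^{l(d)}/H, where ζ is the Riemann zeta function and K₁(d) = d·(12d²·2^{d(d−2)}·(d+1)^{d/2} + 2^{d+2}·p(d)·(2·p(d)−1)^{s(d)}), with p(d) = 4^{(4^{d+1}−1)/3}·d^{4^{d+1}} and s(d) = 3·(2d+3)^{2^{d+1}}·d^{(16^{d+1}−1)·⌈log d / log 2⌉}. -/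

import Mathlib

open MeasureTheory Set

noncomputable section

def lfun (d : ℕ) : ℕ := if d = 2 then 1 else 0

def algSet (d : ℕ) (H : ℝ) : Set ℝ :=
  {α : ℝ | ∃ P : Polynomial ℤ, Irreducible P ∧ P.natDegree = d ∧
    (∀ k, |(P.coeff k : ℝ)| ≤ H) ∧ Polynomial.aeval α P = 0}

/-- The domain of integration `Δ_d(x)`. -/
def DeltaDom (d : ℕ) (x : ℝ) : Set (Fin d → ℝ) :=
  {p | (∀ k, |p k| ≤ 1) ∧ |∑ k : Fin d, p k * x ^ ((k : ℕ) + 1)| ≤ 1}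

/-- Koleda's density function `ρ_d`. -/
def rho (d : ℕ) (x : ℝ) : ℝ :=
  ∫ p in DeltaDom d x, |∑ k : Fin d, (((k : ℕ) : ℝ) + 1) * p k * x ^ (k : ℕ)|

/-- `ζ(s)` for positive integers `s`, as a real number. -/
def zetaR (s : ℕ) : ℝ := ∑' n : ℕ, (1 : ℝ) / ((n : ℝ) + 1) ^ s

def pK (d : ℕ) : ℕ := 4 ^ ((4 ^ (d + 1) - 1) / 3) * d ^ (4 ^ (d + 1))

def sK (d : ℕ) : ℕ :=
  3 * (2 * d + 3) ^ (2 ^ (d + 1)) *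
    d ^ ((16 ^ (d + 1) - 1) * ⌈Real.log d / Real.log 2⌉₊)

def K1 (d : ℕ) : ℝ :=
  (d : ℝ) * (12 * (d : ℝ) ^ 2 * 2 ^ (d * (d - 2)) * ((d : ℝ) + 1) ^ ((d : ℝ) / 2)
    + 2 ^ (d + 2) * (pK d : ℝ) * (2 * (pK d : ℝ) - 1) ^ sK d)

namespace KL

theorem integral_pi_succ (n : ℕ) (μ : Measure ℝ) [IsFiniteMeasure μ] (f : (Fin (n+1) → ℝ) → ℝ) :
    ∫ p, f p ∂(Measure.pi fun _ => μ) =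
      ∫ z : ℝ × (Fin n → ℝ), f (Fin.cons z.1 z.2) ∂(μ.prod (Measure.pi fun _ => μ)) := by
  rw [← ((measurePreserving_piFinSuccAbove (fun _ : Fin (n+1) => μ) 0).symm).integral_comp']
  refine integral_congr_ae (Filter.Eventually.of_forall fun z => ?_)
  simp only [MeasurableEquiv.piFinSuccAbove_symm_apply, Fin.insertNthEquiv, Equiv.coe_fn_mk,
    Fin.insertNth_zero']

theorem bdd_integrable {α : Type*} [MeasurableSpace α] (μ : Measure α) [IsFiniteMeasure μ]
    (f : α → ℝ) (hf : Measurable f) (B : ℝ) (hb : ∀ p, |f p| ≤ B) : Integrable f μ :=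
  Integrable.of_bound hf.aestronglyMeasurable B (Filter.Eventually.of_forall hb)

theorem meas_cons (n : ℕ) : Measurable (fun z : ℝ × (Fin n → ℝ) => (Fin.cons z.1 z.2 : Fin (n+1) → ℝ)) := by
  refine measurable_pi_lambda _ fun i => ?_
  refine Fin.cases ?_ (fun j => ?_) i
  · simpa using measurable_fst
  · simpa [Function.comp_def] using (measurable_pi_apply j).comp (measurable_snd (α := ℝ) (β := Fin n → ℝ))

theorem abs_integral_le {α : Type*} [MeasurableSpace α] (μ : Measure α) [IsFiniteMeasure μ]
    (f : α → ℝ) (C M : ℝ) (hC : 0 ≤ C) (hM : μ.real univ ≤ M) (h : ∀ x, |f x| ≤ C) :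
    |∫ x, f x ∂μ| ≤ C * M := by
  have := norm_integral_le_of_norm_le_const (μ := μ) (f := f) (C := C) (Filter.Eventually.of_forall h)
  exact this.trans (mul_le_mul_of_nonneg_left hM hC)

theorem pi_real_univ (n : ℕ) (μ : Measure ℝ) [IsFiniteMeasure μ] :
    (Measure.pi fun _ : Fin n => μ).real univ = (μ.real univ) ^ n := by
  simp [Measure.real, Measure.pi_univ]

theorem hybrid (μ ν : Measure ℝ) [IsFiniteMeasure μ] [IsFiniteMeasure ν]
    (M ε B : ℝ) (hM1 : 1 ≤ M) (hμ : μ.real univ ≤ M) (hν : ν.real univ ≤ M) (hε : 0 ≤ ε) (n : ℕ) :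
    ∀ (f : (Fin n → ℝ) → ℝ), Measurable f → (∀ p, |f p| ≤ B) →
    (∀ p i, |∫ t, f (Function.update p i t) ∂μ - ∫ t, f (Function.update p i t) ∂ν| ≤ ε) →
    |∫ p, f p ∂(Measure.pi fun _ => μ) - ∫ p, f p ∂(Measure.pi fun _ => ν)| ≤ n * M ^ n * ε := by
  induction n with
  | zero =>
    intro f hf hb h
    rw [Measure.pi_of_empty, Measure.pi_of_empty]
    simp
  | succ n ih =>
    intro f hf hb h
    rw [integral_pi_succ, integral_pi_succ]
    have hm : Measurable (fun z : ℝ × (Fin n → ℝ) => f (Fin.cons z.1 z.2)) := hf.comp (meas_cons n)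
    have hI : ∀ (ρ : Measure (ℝ × (Fin n → ℝ))) [IsFiniteMeasure ρ],
        Integrable (fun z : ℝ × (Fin n → ℝ) => f (Fin.cons z.1 z.2)) ρ :=
      fun ρ _ => bdd_integrable ρ _ hm B (fun z => hb _)
    have h1 : ∀ t, |∫ q, f (Fin.cons t q) ∂(Measure.pi fun _ : Fin n => μ)
        - ∫ q, f (Fin.cons t q) ∂(Measure.pi fun _ : Fin n => ν)| ≤ n * M ^ n * ε := by
      intro t
      refine ih (fun q => f (Fin.cons t q)) (hm.comp measurable_prodMk_left) (fun _ => hb _) ?_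
      intro p i
      have := h (Fin.cons t p) i.succ
      simpa only [Fin.cons_update] using this
    have h2 : ∀ q : Fin n → ℝ, |∫ t, f (Fin.cons t q) ∂μ - ∫ t, f (Fin.cons t q) ∂ν| ≤ ε := by
      intro q
      have := h (Fin.cons 0 q) 0
      simpa only [Fin.update_cons_zero] using this
    have e1 : |∫ z : ℝ × (Fin n → ℝ), f (Fin.cons z.1 z.2) ∂(μ.prod (Measure.pi fun _ => μ))
       - ∫ z : ℝ × (Fin n → ℝ), f (Fin.cons z.1 z.2) ∂(μ.prod (Measure.pi fun _ => ν))|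
        ≤ (n * M ^ n * ε) * M := by
      rw [integral_prod _ (hI _), integral_prod _ (hI _),
        ← integral_sub (hI _).integral_prod_left (hI _).integral_prod_left]
      exact abs_integral_le _ _ _ _ (by positivity) hμ h1
    have e2 : |∫ z : ℝ × (Fin n → ℝ), f (Fin.cons z.1 z.2) ∂(μ.prod (Measure.pi fun _ => ν))
       - ∫ z : ℝ × (Fin n → ℝ), f (Fin.cons z.1 z.2) ∂(ν.prod (Measure.pi fun _ => ν))|
        ≤ ε * M ^ n := by
      rw [integral_prod_symm _ (hI _), integral_prod_symm _ (hI _),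
        ← integral_sub (hI _).integral_prod_right (hI _).integral_prod_right]
      refine abs_integral_le _ _ _ _ hε ?_ h2
      rw [pi_real_univ]
      exact pow_le_pow_left₀ measureReal_nonneg hν n
    have e3 : ε * M ^ n ≤ ε * M ^ (n+1) := by
      apply mul_le_mul_of_nonneg_left _ hε
      exact pow_le_pow_right₀ hM1 (Nat.le_succ n)
    rw [abs_le] at e1 e2 ⊢
    push_cast
    have : (n * M ^ n * ε) * M = n * M ^ (n+1) * ε := by ring
    constructor <;> nlinarith

/-- integers in `[-T,T]` -/
def zbox (T : ℝ) : Finset ℤ := Finset.Icc (-⌊T⌋) ⌊T⌋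

theorem mem_zbox {T : ℝ} {a : ℤ} : a ∈ zbox T ↔ |(a : ℝ)| ≤ T := by
  rw [zbox, Finset.mem_Icc, abs_le, Int.le_floor, ← Int.cast_le (R := ℝ)]
  constructor
  · rintro ⟨h1, h2⟩
    refine ⟨?_, h2⟩
    have := Int.floor_le T
    push_cast at h1
    linarith
  · rintro ⟨h1, h2⟩
    refine ⟨?_, h2⟩
    have : (-a) ≤ ⌊T⌋ := Int.le_floor.2 (by push_cast; linarith)
    exact_mod_cast (by linarith : -⌊T⌋ ≤ a)

/-- scaled lattice points -/
def sbox (T : ℝ) : Finset ℝ := (zbox T).image fun a : ℤ => (a : ℝ) / T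

def muT (T : ℝ) : Measure ℝ := ENNReal.ofReal (1 / T) • Measure.count.restrict (sbox T : Set ℝ)

def nu1 : Measure ℝ := volume.restrict (Icc (-1) 1)

instance (T : ℝ) : IsFiniteMeasure (Measure.count.restrict (sbox T : Set ℝ)) :=
  ⟨by rw [Measure.restrict_apply_univ]; exact Measure.count_apply_lt_top.2 (Finset.finite_toSet _)⟩

instance (T : ℝ) : IsFiniteMeasure (muT T) := by
  unfold muT
  exact Measure.smul_finite _ ENNReal.ofReal_ne_top

instance : IsFiniteMeasure nu1 := by unfold nu1; infer_instance

theorem muT_real (T : ℝ) (hT : 0 < T) (S : Set ℝ) (hS : MeasurableSet S) :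
    (muT T).real S = ({a ∈ zbox T | (a : ℝ) / T ∈ S} : Set ℤ).ncard / T := by
  have hinj : Function.Injective (fun a : ℤ => (a : ℝ) / T) := by
    intro a b h
    have := (div_left_inj' hT.ne').1 h
    exact_mod_cast this
  unfold muT
  rw [measureReal_ennreal_smul_apply, ENNReal.toReal_ofReal (by positivity)]
  have : (Measure.count.restrict (sbox T : Set ℝ)).real S
     = ({a ∈ zbox T | (a : ℝ) / T ∈ S} : Set ℤ).ncard := by
    rw [measureReal_restrict_apply hS, Measure.real, Measure.count_apply
      ((hS.inter (Finset.measurableSet _)))]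
    have e : S ∩ (sbox T : Set ℝ) = (fun a : ℤ => (a : ℝ) / T) '' {a | a ∈ zbox T ∧ (a : ℝ) / T ∈ S} := by
      ext x
      simp only [sbox, Finset.coe_image, mem_inter_iff, mem_image, mem_ofPred_eq, Finset.mem_coe]
      constructor
      · rintro ⟨h, a, ha, rfl⟩; exact ⟨a, ⟨ha, h⟩, rfl⟩
      · rintro ⟨a, ⟨ha, h⟩, rfl⟩; exact ⟨h, a, ha, rfl⟩
    rw [e, hinj.injOn.encard_image]
    have hfin : ({a | a ∈ zbox T ∧ (a : ℝ) / T ∈ S} : Set ℤ).Finite :=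
      (Finset.finite_toSet (zbox T)).subset fun a ha => ha.1
    rw [← hfin.cast_ncard_eq]
    simp only [ENat.toENNReal_coe, ENNReal.toReal_natCast]
  rw [this]; ring


theorem nu1_real (S : Set ℝ) (hS : MeasurableSet S) : nu1.real S = volume.real (S ∩ Icc (-1) 1) := by
  rw [nu1, measureReal_restrict_apply hS]

theorem discrep (T : ℝ) (hT : 0 < T) (S : Set ℝ) (hS : S.OrdConnected) :
    |(muT T).real S - nu1.real S| ≤ 1 / T := by
  rw [muT_real T hT S hS.measurableSet, nu1_real S hS.measurableSet]
  have hS' : (S ∩ Icc (-1) 1).OrdConnected := hS.inter ordConnected_Icc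
  have hset : ({a ∈ zbox T | (a : ℝ) / T ∈ S} : Set ℤ) = {a : ℤ | (a : ℝ) / T ∈ S ∩ Icc (-1) 1} := by
    ext a
    have : a ∈ zbox T ↔ (a : ℝ) / T ∈ Icc (-1 : ℝ) 1 := by
      rw [mem_zbox, mem_Icc, abs_le, div_le_iff₀ hT, le_div_iff₀ hT]; simp
    simp only [mem_ofPred_eq, mem_inter_iff, this]; tauto
  rw [hset]
  have hbA : BddAbove (S ∩ Icc (-1:ℝ) 1) := bddAbove_Icc.mono inter_subset_right
  have hbB : BddBelow (S ∩ Icc (-1:ℝ) 1) := bddBelow_Icc.mono inter_subset_right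
  generalize S ∩ Icc (-1:ℝ) 1 = A at *
  rcases A.eq_empty_or_nonempty with rfl | hne
  · simp; positivity
  set a := sInf A
  set b := sSup A
  have hab : a ≤ b := Real.sInf_le_sSup _ hbB hbA
  have hsub : A ⊆ Icc a b := fun x hx => ⟨csInf_le hbB hx, le_csSup hbA hx⟩
  have hsup : Ioo a b ⊆ A := by
    rintro x ⟨h1, h2⟩
    obtain ⟨y, hy, hyx⟩ := exists_lt_of_csInf_lt hne h1
    obtain ⟨z, hz, hzx⟩ := exists_lt_of_lt_csSup hne h2
    exact hS'.out hy hz ⟨hyx.le, hzx.le⟩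
  have hvol : volume.real A = b - a := by
    apply le_antisymm
    · refine (measureReal_mono hsub (by simp)).trans ?_
      simp [hab]
    · have : volume.real (Ioo a b) = b - a := by simp [hab]
      rw [← this]
      exact measureReal_mono hsup (ne_top_of_le_ne_top (by simp) (measure_mono hsub))
  have hfin : ({c : ℤ | (c : ℝ) / T ∈ A} : Set ℤ) ⊆ (Finset.Icc ⌈a * T⌉ ⌊b * T⌋ : Finset ℤ) := by
    intro c hc
    have := hsub hc
    rw [mem_Icc, le_div_iff₀ hT, div_le_iff₀ hT] at this
    simp only [Finset.coe_Icc, mem_Icc, Int.ceil_le, Int.le_floor]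
    exact this
  have hfin2 : ((Finset.Ioo ⌊a * T⌋ ⌈b * T⌉ : Finset ℤ) : Set ℤ) ⊆ {c : ℤ | (c : ℝ) / T ∈ A} := by
    intro c hc
    simp only [Finset.coe_Ioo, mem_Ioo, Int.floor_lt, Int.lt_ceil] at hc
    apply hsup
    rw [mem_Ioo, lt_div_iff₀ hT, div_lt_iff₀ hT]
    exact hc
  have h1 := Set.ncard_le_ncard hfin (Finset.finite_toSet _)
  have h2 := Set.ncard_le_ncard hfin2 ((Finset.finite_toSet _).subset hfin)
  rw [Set.ncard_coe_finset, Int.card_Icc] at h1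
  rw [Set.ncard_coe_finset, Int.card_Ioo] at h2
  generalize ({c : ℤ | (c : ℝ) / T ∈ A} : Set ℤ).ncard = N at *
  rw [hvol]
  have haT : a * T ≤ b * T := mul_le_mul_of_nonneg_right hab hT.le
  have f1 : (N : ℝ) ≤ b * T - a * T + 1 := by
    have : (N : ℤ) ≤ max (⌊b * T⌋ + 1 - ⌈a * T⌉) 0 := by omega
    have h3 : (N : ℝ) ≤ max ((⌊b * T⌋ : ℝ) + 1 - ⌈a * T⌉) 0 := by exact_mod_cast this
    refine h3.trans (max_le ?_ (by linarith))
    have := Int.floor_le (b * T)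
    have := Int.le_ceil (a * T)
    linarith
  have f2 : b * T - a * T - 1 ≤ N := by
    have : (⌈b * T⌉ - ⌊a * T⌋ - 1 : ℤ) ≤ N := by omega
    have h3 : (⌈b * T⌉ - ⌊a * T⌋ - 1 : ℝ) ≤ N := by exact_mod_cast this
    have := Int.floor_le (a * T)
    have := Int.le_ceil (b * T)
    linarith
  have : (N : ℝ) / T - (b - a) = (N - (b * T - a * T)) / T := by field_simp
  rw [this, abs_div, abs_of_pos hT]
  apply div_le_div_of_nonneg_right _ hT.le
  rw [abs_le]; constructor <;> linarith

theorem nu1_mass : nu1.real univ ≤ 3 := by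
  rw [nu1_real _ MeasurableSet.univ, univ_inter, Real.volume_real_Icc]; norm_num

theorem muT_mass (T : ℝ) (hT : 1 ≤ T) : (muT T).real univ ≤ 3 := by
  have h := discrep T (by linarith) univ ordConnected_univ
  have h2 : nu1.real univ = 2 := by
    rw [nu1_real _ MeasurableSet.univ, univ_inter, Real.volume_real_Icc]; norm_num
  have : 1 / T ≤ 1 := by rw [div_le_one (by linarith)]; exact hT
  rw [abs_le] at h
  linarith

end KL

namespace KL
open Polynomial in
def pol {n : ℕ} (p : Fin n → ℝ) : Polynomial ℝ := ∑ i : Fin n, C (p i) * X ^ (i : ℕ)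

def ev {n : ℕ} (p : Fin n → ℝ) (x : ℝ) : ℝ := ∑ i : Fin n, p i * x ^ (i : ℕ)

def nI (I : Set ℝ) {n : ℕ} (p : Fin n → ℝ) : ℕ := ({x | x ∈ I ∧ ev p x = 0} : Set ℝ).ncard

theorem eval_pol {n : ℕ} (p : Fin n → ℝ) (x : ℝ) : (pol p).eval x = ev p x := by
  simp [pol, ev, Polynomial.eval_finsetSum]

theorem coeff_pol {n : ℕ} (p : Fin n → ℝ) (i : Fin n) : (pol p).coeff i = p i := by
  simp only [pol, Polynomial.finsetSum_coeff, Polynomial.coeff_C_mul, Polynomial.coeff_X_pow]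
  rw [Finset.sum_eq_single i]
  · simp
  · intro j _ hj
    have : (i : ℕ) ≠ j := fun h => hj (Fin.ext h.symm)
    simp [this]
  · simp

theorem pol_ne_zero {n : ℕ} {p : Fin n → ℝ} (hp : p ≠ 0) : pol p ≠ 0 := by
  intro h
  apply hp
  ext i
  have := coeff_pol p i
  rw [h] at this
  simpa using this.symm

theorem natDegree_pol {n : ℕ} (p : Fin (n+1) → ℝ) : (pol p).natDegree ≤ n := by
  unfold pol
  refine Polynomial.natDegree_sum_le_of_forall_le _ _ fun i _ => ?_
  refine (Polynomial.natDegree_C_mul_X_pow_le _ _).trans ?_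
  have := i.2
  omega

theorem rts_subset {n : ℕ} (I : Set ℝ) (p : Fin n → ℝ) (hp : p ≠ 0) :
    ({x | x ∈ I ∧ ev p x = 0} : Set ℝ) ⊆ ((pol p).roots.toFinset : Finset ℝ) := by
  rintro x ⟨_, hx⟩
  simp [pol_ne_zero hp, Polynomial.IsRoot, eval_pol, hx]

theorem rts_finite {n : ℕ} (I : Set ℝ) (p : Fin n → ℝ) (hp : p ≠ 0) :
    ({x | x ∈ I ∧ ev p x = 0} : Set ℝ).Finite :=
  (Finset.finite_toSet _).subset (rts_subset I p hp)

theorem ncard_subsingleton_ord {I : Set ℝ} (hI : I.OrdConnected) : I.ncard ≤ 1 := by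
  by_contra h
  have hfin : I.Finite := by
    by_contra hinf
    rw [Set.Infinite.ncard hinf] at h; omega
  have h1 : 1 < I.ncard := by omega
  rw [Set.one_lt_ncard_iff hfin] at h1
  obtain ⟨a, b, ha, hb, hab⟩ := h1
  rcases lt_or_gt_of_ne hab with h | h
  · exact (Icc_infinite h) (hfin.subset (hI.out ha hb))
  · exact (Icc_infinite h) (hfin.subset (hI.out hb ha))

theorem nI_le {n : ℕ} (hn : 1 ≤ n) (I : Set ℝ) (hI : I.OrdConnected) (p : Fin (n+1) → ℝ) :
    nI I p ≤ n := by
  by_cases hp : p = 0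
  · subst hp
    have : ({x | x ∈ I ∧ ev (0 : Fin (n+1) → ℝ) x = 0} : Set ℝ) = I := by
      ext x; simp [ev]
    rw [nI, this]
    exact (ncard_subsingleton_ord hI).trans hn
  · refine (Set.ncard_le_ncard (rts_subset I p hp) (Finset.finite_toSet _)).trans ?_
    rw [Set.ncard_coe_finset]
    refine (Multiset.toFinset_card_le _).trans ((Polynomial.card_roots' _).trans (natDegree_pol p))

def cell (I : Set ℝ) (Z : Finset ℝ) (m : ℕ) : Set ℝ :=
  {x | x ∈ I ∧ x ∉ Z ∧ (Z.filter (· < x)).card = m}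

theorem cell_ord (I : Set ℝ) (hI : I.OrdConnected) (Z : Finset ℝ) (m : ℕ) :
    (cell I Z m).OrdConnected := by
  refine ⟨fun x hx y hy w hw => ?_⟩
  have hmono : ∀ {a b : ℝ}, a ≤ b → Z.filter (· < a) ⊆ Z.filter (· < b) := by
    intro a b hab z hz
    rw [Finset.mem_filter] at hz ⊢
    exact ⟨hz.1, hz.2.trans_le hab⟩
  have h1 := Finset.card_le_card (hmono hw.1)
  have h2 := Finset.card_le_card (hmono hw.2)
  have hxm := hx.2.2
  have hym := hy.2.2
  refine ⟨hI.out hx.1 hy.1 hw, fun hwZ => ?_, by omega⟩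
  have hlt : w < y := lt_of_le_of_ne hw.2 (fun h => hy.2.1 (h ▸ hwZ))
  have : (Z.filter (· < w)).card < (Z.filter (· < y)).card := by
    apply Finset.card_lt_card
    refine Finset.ssubset_iff_subset_ne.2 ⟨hmono hw.2, fun h => ?_⟩
    have : w ∈ Z.filter (· < y) := Finset.mem_filter.2 ⟨hwZ, hlt⟩
    rw [← h] at this
    exact lt_irrefl _ (Finset.mem_filter.1 this).2
  omega

open Classical in
theorem count_decomp (I A : Set ℝ) (Z : Finset ℝ) (hfin : (I ∩ A).Finite) :
    (I ∩ A).ncard = (∑ z ∈ Z, if z ∈ I ∩ A then 1 else 0)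
      + ∑ m ∈ Finset.range (Z.card + 1), (cell I Z m ∩ A).ncard := by
  set F := hfin.toFinset with hF
  have hFm : ∀ x, x ∈ F ↔ x ∈ I ∩ A := fun x => by simp [hF]
  have e0 : (I ∩ A).ncard = F.card := Set.ncard_eq_toFinset_card _ hfin
  have e1 : (∑ z ∈ Z, if z ∈ I ∩ A then 1 else 0) = (F.filter (· ∈ Z)).card := by
    rw [← Finset.sum_filter, Finset.sum_const, smul_eq_mul, mul_one]
    congr 1
    ext x
    simp only [Finset.mem_filter, hFm]; tauto
  have e2 : (F.filter (· ∉ Z)).card = ∑ m ∈ Finset.range (Z.card + 1), (cell I Z m ∩ A).ncard := by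
    rw [Finset.card_eq_sum_card_fiberwise (f := fun x => (Z.filter (· < x)).card)
      (t := Finset.range (Z.card + 1))]
    · refine Finset.sum_congr rfl fun m _ => ?_
      rw [← Set.ncard_coe_finset]
      congr 1
      ext x
      simp only [Finset.coe_filter, Finset.mem_filter, hFm, mem_ofPred_eq, cell, mem_inter_iff]
      tauto
    · intro x _
      simp only [Finset.coe_range, mem_Iio]
      exact Nat.lt_succ_of_le (Finset.card_filter_le _ _)
  rw [e0, e1, ← e2, Finset.card_filter_add_card_filter_not]

theorem sum_ind_bound {ι : Type*} (T : ℝ) (hT : 0 < T) (s : Finset ι) (S : ι → Set ℝ)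
    (hS : ∀ i ∈ s, (S i).OrdConnected) (f : ℝ → ℝ)
    (hf : ∀ t, f t = ∑ i ∈ s, (S i).indicator 1 t) :
    |∫ t, f t ∂(muT T) - ∫ t, f t ∂nu1| ≤ s.card / T := by
  have key : ∀ (μ : Measure ℝ) [IsFiniteMeasure μ], ∫ t, f t ∂μ = ∑ i ∈ s, μ.real (S i) := by
    intro μ _
    simp_rw [hf]
    rw [integral_finsetSum]
    · exact Finset.sum_congr rfl fun i hi => integral_indicator_one (hS i hi).measurableSet
    · intro i hi
      exact (integrable_const (1:ℝ)).indicator (hS i hi).measurableSet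
  rw [key, key, ← Finset.sum_sub_distrib]
  refine (Finset.abs_sum_le_sum_abs _ _).trans ?_
  refine (Finset.sum_le_sum fun i hi => discrep T hT _ (hS i hi)).trans ?_
  rw [Finset.sum_const, nsmul_eq_mul]
  apply le_of_eq; ring

theorem ev_update {n : ℕ} (p : Fin n → ℝ) (k : Fin n) (t x : ℝ) :
    ev (Function.update p k t) x = ev (Function.update p k 0) x + t * x ^ (k : ℕ) := by
  unfold ev
  rw [Fintype.sum_eq_add_sum_compl k, Fintype.sum_eq_add_sum_compl (a := k)]
  simp only [Function.update_self]
  have : ∀ s : ℝ, ∑ i ∈ ({k} : Finset (Fin n))ᶜ, Function.update p k s i * x ^ (i:ℕ)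
     = ∑ i ∈ ({k} : Finset (Fin n))ᶜ, p i * x ^ (i:ℕ) := by
    intro s
    refine Finset.sum_congr rfl fun i hi => ?_
    rw [Function.update_of_ne (by simpa using hi)]
  rw [this, this]; ring

open Polynomial in
def critR {n : ℕ} (q : Fin n → ℝ) (k : ℕ) : Polynomial ℝ :=
  X * derivative (pol q) - C (k : ℝ) * pol q

theorem critR_coeff {n : ℕ} (q : Fin n → ℝ) (k : ℕ) (i : Fin n) :
    (critR q k).coeff i = ((i : ℝ) - k) * q i := by
  rw [critR, Polynomial.coeff_sub, Polynomial.coeff_C_mul, coeff_pol]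
  rcases i with ⟨i, hi⟩
  cases i with
  | zero => simp
  | succ i =>
    rw [show (((⟨i+1, hi⟩ : Fin n) : ℕ)) = i + 1 from rfl, Polynomial.coeff_X_mul, Polynomial.coeff_derivative]
    have := coeff_pol q ⟨i+1, hi⟩
    simp only at this
    rw [this]; push_cast; ring

theorem critR_ne {n : ℕ} (q : Fin n → ℝ) (k : Fin n) (hk : q k = 0) (hq : q ≠ 0) : critR q k ≠ 0 := by
  intro h
  apply hq
  ext i
  have := critR_coeff q k i
  rw [h] at this
  simp only [Polynomial.coeff_zero] at this
  rcases mul_eq_zero.1 this.symm with h1 | h1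
  · have : i = k := by
      apply Fin.ext
      have : ((i:ℕ):ℝ) = (k:ℕ) := by linarith
      exact_mod_cast this
    rw [this]; exact hk
  · exact h1

theorem critR_deg {n : ℕ} (q : Fin (n+1) → ℝ) (k : ℕ) : (critR q k).natDegree ≤ n := by
  unfold critR
  refine (Polynomial.natDegree_sub_le _ _).trans (max_le ?_ ?_)
  · by_cases h : (pol q).natDegree = 0
    · rw [Polynomial.derivative_of_natDegree_zero h]; simp
    refine (Polynomial.natDegree_mul_le).trans ?_
    have := Polynomial.natDegree_derivative_lt h
    have := natDegree_pol q
    have : (Polynomial.X : Polynomial ℝ).natDegree ≤ 1 := Polynomial.natDegree_X_le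
    omega
  · exact (Polynomial.natDegree_C_mul_le _ _).trans (natDegree_pol q)

theorem g_inj {n : ℕ} (q : Fin n → ℝ) (k : ℕ) (J : Set ℝ) (hJ : J.OrdConnected)
    (h0 : (0:ℝ) ∉ J) (hR : ∀ x ∈ J, (critR q k).eval x ≠ 0) :
    ContinuousOn (fun x => - ev q x / x ^ k) J ∧ InjOn (fun x => - ev q x / x ^ k) J := by
  have hd : ∀ x ∈ J, HasDerivAt (fun x => - ev q x / x ^ k)
      ((-(Polynomial.derivative (pol q)).eval x * x ^ k - (- ev q x) * (k * x ^ (k-1))) / (x^k)^2) x := by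
    intro x hx
    have hx0 : x ≠ 0 := fun h => h0 (h ▸ hx)
    have h1 : HasDerivAt (fun x => - ev q x) (-(Polynomial.derivative (pol q)).eval x) x := by
      have := ((pol q).hasDerivAt x).neg
      refine this.congr_of_eventuallyEq (Filter.Eventually.of_forall fun y => ?_)
      simp [eval_pol]
    exact h1.div (hasDerivAt_pow k x) (pow_ne_zero _ hx0)
  have hc : ContinuousOn (fun x => - ev q x / x ^ k) J :=
    fun x hx => (hd x hx).continuousAt.continuousWithinAt
  refine ⟨hc, ?_⟩
  have key : ∀ x ∈ J, ∀ y ∈ J, x < y → - ev q x / x ^ k ≠ - ev q y / y ^ k := by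
    intro x hx y hy hxy heq
    have hsub := hJ.out hx hy
    obtain ⟨c, hc1, hc2⟩ := exists_deriv_eq_zero hxy (hc.mono hsub) heq
    have hcJ := hsub (Ioo_subset_Icc_self hc1)
    have hc0 : c ≠ 0 := fun h => h0 (h ▸ hcJ)
    rw [(hd c hcJ).deriv] at hc2
    have h2 := (div_eq_zero_iff.1 hc2).resolve_right (pow_ne_zero _ (pow_ne_zero _ hc0))
    apply hR c hcJ
    have hk : (k : ℝ) * c ^ (k-1) * c = k * c ^ k := by
      cases k with
      | zero => simp
      | succ k => simp [pow_succ]; ring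
    have h3 : (critR q k).eval c * c ^ k = 0 := by
      simp only [critR, Polynomial.eval_sub, Polynomial.eval_mul, Polynomial.eval_X,
        Polynomial.eval_C, eval_pol]
      linear_combination (-c) * h2 + ev q c * hk
    exact (mul_eq_zero.1 h3).resolve_right (pow_ne_zero _ hc0)
  intro x hx y hy heq
  by_contra hne
  rcases lt_or_gt_of_ne hne with h | h
  · exact key x hx y hy h heq
  · exact key y hy x hx h heq.symm

theorem cell_count {n : ℕ} (q : Fin n → ℝ) (k : ℕ) (J : Set ℝ) (hJ : J.OrdConnected)
    (h0 : (0:ℝ) ∉ J) (hR : ∀ x ∈ J, (critR q k).eval x ≠ 0) :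
    ((fun x => - ev q x / x ^ k) '' J).OrdConnected ∧ ∀ t,
      ((J ∩ {x | ev q x + t * x ^ k = 0}).ncard : ℝ)
        = ((fun x => - ev q x / x ^ k) '' J).indicator 1 t := by
  obtain ⟨hc, hinj⟩ := g_inj q k J hJ h0 hR
  refine ⟨(hJ.isPreconnected.image _ hc).ordConnected, fun t => ?_⟩
  have heq : ∀ x ∈ J, (ev q x + t * x ^ k = 0 ↔ - ev q x / x ^ k = t) := by
    intro x hx
    have hx0 : x ^ k ≠ 0 := pow_ne_zero _ fun h => h0 (h ▸ hx)
    rw [div_eq_iff hx0]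
    constructor <;> intro h <;> linarith
  by_cases ht : t ∈ (fun x => - ev q x / x ^ k) '' J
  · rw [indicator_of_mem ht]
    obtain ⟨x, hx, hxt⟩ := ht
    have : J ∩ {x | ev q x + t * x ^ k = 0} = {x} := by
      ext y
      simp only [mem_inter_iff, mem_ofPred_eq, mem_singleton_iff]
      constructor
      · rintro ⟨h1, h2⟩
        exact hinj h1 hx (((heq y h1).1 h2).trans hxt.symm)
      · rintro rfl
        exact ⟨hx, (heq y hx).2 hxt⟩
    rw [this]; simp
  · rw [indicator_of_notMem ht]
    have : J ∩ {x | ev q x + t * x ^ k = 0} = ∅ := by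
      ext y
      simp only [mem_inter_iff, mem_ofPred_eq, mem_empty_iff_false, iff_false]
      rintro ⟨h1, h2⟩
      exact ht ⟨y, h1, (heq y h1).1 h2⟩
    rw [this]; simp

open Classical in
theorem section_bound (n : ℕ) (I : Set ℝ) (hI : I.OrdConnected) (T : ℝ) (hT : 0 < T)
    (p : Fin (n+1) → ℝ) (k : Fin (n+1)) :
    |∫ t, (nI I (Function.update p k t) : ℝ) ∂(muT T) - ∫ t, (nI I (Function.update p k t) : ℝ) ∂nu1|
      ≤ (2 * n + 5) / T := by
  set q := Function.update p k 0 with hq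
  have hev : ∀ t x, ev (Function.update p k t) x = ev q x + t * x ^ (k:ℕ) := ev_update p k
  by_cases hq0 : q = 0
  · -- degenerate case
    set S : Fin 2 → Set ℝ := ![{t | t ≠ 0 ∧ (0:ℝ) ∈ I ∧ (k:ℕ) ≠ 0}, {t | t = 0 ∧ I.ncard = 1}] with hS
    have hev2 : ∀ t x, ev (Function.update p k t) x = t * x ^ (k:ℕ) := by
      intro t x; rw [hev, hq0]; simp [ev]
    have hz : ∀ x : ℝ, ∀ t ≠ 0, (t * x ^ (k:ℕ) = 0 ↔ x = 0 ∧ (k:ℕ) ≠ 0) := by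
      intro x t ht
      rw [mul_eq_zero, pow_eq_zero_iff']; tauto
    have hval : ∀ t, t ≠ 0 → (nI I (Function.update p k t) : ℝ) = if (0:ℝ) ∈ I ∧ (k:ℕ) ≠ 0 then 1 else 0 := by
      intro t ht
      unfold nI
      simp_rw [hev2, hz _ t ht]
      split_ifs with h
      · have : ({x | x ∈ I ∧ x = 0 ∧ (k:ℕ) ≠ 0} : Set ℝ) = {0} := by
          ext x; simp only [mem_ofPred_eq, mem_singleton_iff]
          constructor
          · tauto
          · rintro rfl; tauto
        rw [this]; simp
      · have : ({x | x ∈ I ∧ x = 0 ∧ (k:ℕ) ≠ 0} : Set ℝ) = ∅ := by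
          ext x; simp only [mem_ofPred_eq, mem_empty_iff_false, iff_false]
          rintro ⟨h1, rfl, h2⟩; tauto
        rw [this]; simp
    have hval0 : (nI I (Function.update p k 0) : ℝ) = I.ncard := by
      unfold nI
      simp_rw [hev2]
      simp
    set c : ℝ := if (0:ℝ) ∈ I ∧ (k:ℕ) ≠ 0 then 1 else 0 with hc
    have hc01 : 0 ≤ c ∧ c ≤ 1 := by rw [hc]; split_ifs <;> norm_num
    have hI1 : (I.ncard : ℝ) ≤ 1 := by exact_mod_cast ncard_subsingleton_ord hI
    have hfun : ∀ t, (nI I (Function.update p k t) : ℝ)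
        = c + (I.ncard - c) * ({0} : Set ℝ).indicator 1 t := by
      intro t
      by_cases ht : t = 0
      · subst ht; rw [hval0]; simp
      · rw [hval t ht, indicator_of_notMem (by simpa using ht)]; simp
    have key : ∀ (μ : Measure ℝ) [IsFiniteMeasure μ],
        ∫ t, (nI I (Function.update p k t) : ℝ) ∂μ = c * μ.real univ + (I.ncard - c) * μ.real {0} := by
      intro μ _
      simp_rw [hfun]
      rw [integral_add (integrable_const _), integral_const, integral_const_mul,
        integral_indicator_one (measurableSet_singleton _)]
      · simp [mul_comm]
      · exact ((integrable_const (1:ℝ)).indicator (measurableSet_singleton _)).const_mul _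
    rw [key, key]
    have d1 := discrep T hT univ ordConnected_univ
    have d2 := discrep T hT {0} ordConnected_singleton
    have hn0 : (0:ℝ) ≤ n := by positivity
    have hN0 : (0:ℝ) ≤ I.ncard := by positivity
    have hT' : 0 < 1 / T := by positivity
    have e : (2 * (n:ℝ) + 5) / T = (2 * n + 5) * (1/T) := by ring
    rw [e]
    set u := (muT T).real univ - nu1.real univ
    set v := (muT T).real {0} - nu1.real {0}
    have : c * (muT T).real univ + (I.ncard - c) * (muT T).real {0} -
      (c * nu1.real univ + (I.ncard - c) * nu1.real {0}) = c * u + (I.ncard - c) * v := by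
      simp only [u, v]; ring
    rw [this]
    refine (abs_add_le _ _).trans ?_
    rw [abs_mul, abs_mul]
    have a1 : |c| ≤ 1 := abs_le.2 ⟨by linarith, by linarith⟩
    have a2 : |(I.ncard : ℝ) - c| ≤ 1 := abs_le.2 ⟨by linarith, by linarith⟩
    have b1 : |c| * |u| ≤ 1 * (1/T) := mul_le_mul a1 d1 (abs_nonneg _) zero_le_one
    have b2 : |(I.ncard : ℝ) - c| * |v| ≤ 1 * (1/T) := mul_le_mul a2 d2 (abs_nonneg _) zero_le_one
    nlinarith
  · have hqk : q k = 0 := by simp [hq]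
    have hRne := critR_ne q k hqk hq0
    set Z : Finset ℝ := insert 0 (critR q k).roots.toFinset with hZ
    have hZc : Z.card ≤ n + 1 := by
      refine (Finset.card_insert_le _ _).trans ?_
      have := (Multiset.toFinset_card_le (critR q k).roots).trans (Polynomial.card_roots' _)
      have := critR_deg q k
      omega
    have hJ := fun m => cell_count q k (cell I Z m) (cell_ord I hI Z m)
      (fun h => h.2.1 (by simp [hZ]))
      (fun x hx h => hx.2.1 (by simp [hZ, hRne, h]))
    set S : ℝ ⊕ ℕ → Set ℝ := Sum.elim (fun z => {t | z ∈ I ∧ ev q z + t * z ^ (k:ℕ) = 0})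
      (fun m => (fun x => - ev q x / x ^ (k:ℕ)) '' (cell I Z m)) with hS
    have hb := sum_ind_bound T hT (Z.disjSum (Finset.range (Z.card + 1))) S ?_
      (fun t => (nI I (Function.update p k t) : ℝ)) ?_
    · refine hb.trans ?_
      apply div_le_div_of_nonneg_right _ hT.le
      rw [Finset.card_disjSum, Finset.card_range]
      have : (Z.card : ℝ) ≤ n + 1 := by exact_mod_cast hZc
      push_cast; linarith
    · rintro (z | m) _
      · simp only [hS, Sum.elim_inl]
        refine ⟨fun t ht s hs w hw => ⟨ht.1, ?_⟩⟩
        have h1 := ht.2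
        have h2 := hs.2
        by_cases hz : z ^ (k:ℕ) = 0
        · rw [hz] at h1 ⊢; simpa using h1
        · have : t = s := mul_right_cancel₀ hz (by linarith)
          subst this
          have : w = t := le_antisymm hw.2 hw.1
          rw [this]; exact h1
      · exact (hJ m).1
    · intro t
      rw [Finset.sum_disjSum]
      have hp0 : Function.update p k t ≠ 0 := by
        intro h
        apply hq0
        ext i
        by_cases hi : i = k
        · rw [hi]; simpa using hqk
        · have := congrFun h i
          rw [Function.update_of_ne hi] at this
          rw [hq, Function.update_of_ne hi]; exact this
      have hset : ({x | x ∈ I ∧ ev (Function.update p k t) x = 0} : Set ℝ)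
          = I ∩ {x | ev q x + t * x ^ (k:ℕ) = 0} := by
        ext x; simp only [mem_ofPred_eq, mem_inter_iff, hev]
      have hfin := rts_finite I _ hp0
      rw [hset] at hfin
      have := count_decomp I {x | ev q x + t * x ^ (k:ℕ) = 0} Z hfin
      rw [nI, hset, this]
      push_cast
      congr 1
      · refine Finset.sum_congr rfl fun z _ => ?_
        simp only [hS, Sum.elim_inl, indicator, mem_inter_iff, mem_ofPred_eq, Pi.one_apply]
      · exact Finset.sum_congr rfl fun m _ => (hJ m).2 t

end KL

namespace KL

theorem continuous_ev {n : ℕ} : Continuous (fun z : ℝ × (Fin n → ℝ) => ev z.2 z.1) := by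
  unfold ev; fun_prop

theorem closed_root {n : ℕ} (K : Set ℝ) (hK : IsCompact K) :
    IsClosed {p : Fin n → ℝ | ∃ x ∈ K, ev p x = 0} := by
  have : CompactSpace K := isCompact_iff_compactSpace.1 hK
  have h1 : IsClosed {z : K × (Fin n → ℝ) | ev z.2 (z.1 : ℝ) = 0} := by
    refine isClosed_eq ?_ continuous_const
    exact continuous_ev.comp (f := fun z : K × (Fin n → ℝ) => ((z.1 : ℝ), z.2)) (by fun_prop)
  have h2 := isClosedMap_snd_of_compactSpace _ h1
  convert h2 using 1
  ext p
  simp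

theorem meas_root {n : ℕ} (J : Set ℝ) (hJ : J.OrdConnected) :
    MeasurableSet {p : Fin n → ℝ | ∃ x ∈ J, ev p x = 0} := by
  set F := J \ ⋃ (x ∈ J) (y ∈ J), Ioo x y with hF
  have hfin : F.Finite := J.finite_sdiff_iUnion_Ioo
  have e : {p : Fin n → ℝ | ∃ x ∈ J, ev p x = 0} =
      (⋃ (z : ℚ × ℚ) (_ : Icc (z.1 : ℝ) z.2 ⊆ J), {p : Fin n → ℝ | ∃ x ∈ Icc (z.1 : ℝ) z.2, ev p x = 0})
      ∪ {p | ∃ x ∈ F, ev p x = 0} := by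
    ext p
    simp only [mem_ofPred_eq, mem_union, mem_iUnion]
    constructor
    · rintro ⟨x, hx, hp⟩
      by_cases hxF : x ∈ F
      · right; exact ⟨x, hxF, hp⟩
      · left
        have : x ∈ ⋃ (x ∈ J) (y ∈ J), Ioo x y := by
          by_contra h; exact hxF ⟨hx, h⟩
        simp only [mem_iUnion] at this
        obtain ⟨a, ha, b, hb, hab⟩ := this
        obtain ⟨q, hq1, hq2⟩ := exists_rat_btwn hab.1
        obtain ⟨r, hr1, hr2⟩ := exists_rat_btwn hab.2
        refine ⟨(q, r), ?_, x, ⟨hq2.le, hr1.le⟩, hp⟩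
        exact (Icc_subset_Icc hq1.le hr2.le).trans (hJ.out ha hb)
    · rintro (⟨z, hz, x, hx, hp⟩ | ⟨x, hx, hp⟩)
      · exact ⟨x, hz hx, hp⟩
      · exact ⟨x, hx.1, hp⟩
  rw [e]
  refine MeasurableSet.union ?_ (closed_root F hfin.isCompact).measurableSet
  exact MeasurableSet.iUnion fun z => MeasurableSet.iUnion fun _ =>
    (closed_root _ isCompact_Icc).measurableSet

theorem meas_le_encard {n : ℕ} (I : Set ℝ) (hI : I.OrdConnected) (j : ℕ) :
    MeasurableSet {p : Fin n → ℝ | (j : ℕ∞) ≤ ({x | x ∈ I ∧ ev p x = 0} : Set ℝ).encard} := by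
  have e : {p : Fin n → ℝ | (j : ℕ∞) ≤ ({x | x ∈ I ∧ ev p x = 0} : Set ℝ).encard} =
      ⋃ (q : Fin j → ℚ × ℚ)
        (_ : ∀ i i', i ≠ i' → Disjoint (Icc ((q i).1 : ℝ) (q i).2) (Icc ((q i').1 : ℝ) (q i').2)),
        ⋂ i, {p : Fin n → ℝ | ∃ x ∈ I ∩ Icc ((q i).1 : ℝ) (q i).2, ev p x = 0} := by
    ext p
    simp only [mem_ofPred_eq, mem_iUnion, mem_iInter]
    constructor
    · intro h
      obtain ⟨t, hts, htj⟩ := Set.exists_subset_encard_eq h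
      have htf : t.Finite := Set.finite_of_encard_eq_coe htj
      obtain ⟨U, hU, hdis⟩ := htf.t2_separation
      have hcard : htf.toFinset.card = j := by
        have := htf.encard_eq_coe_toFinset_card
        rw [htj] at this
        exact_mod_cast this.symm
      set φ := (htf.toFinset.equivFinOfCardEq hcard).symm
      have hφ : ∀ i, (φ i : ℝ) ∈ t := fun i => htf.mem_toFinset.1 (φ i).2
      have hq : ∀ i, ∃ q : ℚ × ℚ, (φ i : ℝ) ∈ Icc (q.1 : ℝ) q.2 ∧ Icc (q.1 : ℝ) q.2 ⊆ U (φ i) := by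
        intro i
        have hn : U (φ i) ∈ nhds (φ i : ℝ) := (hU _).2.mem_nhds (hU _).1
        obtain ⟨a, b, hab, hs⟩ := mem_nhds_iff_exists_Ioo_subset.1 hn
        obtain ⟨q, hq1, hq2⟩ := exists_rat_btwn hab.1
        obtain ⟨r, hr1, hr2⟩ := exists_rat_btwn hab.2
        exact ⟨(q, r), ⟨hq2.le, hr1.le⟩, fun y hy => hs ⟨hq1.trans_le hy.1, hy.2.trans_lt hr2⟩⟩
      choose q hq1 hq2 using hq
      refine ⟨q, fun i i' hii => ?_, fun i => ⟨φ i, ⟨(hts (hφ i)).1, hq1 i⟩, (hts (hφ i)).2⟩⟩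
      have hne : (φ i : ℝ) ≠ φ i' := fun h => hii (φ.injective (Subtype.ext h))
      exact (hdis (hφ i) (hφ i') hne).mono (hq2 i) (hq2 i')
    · rintro ⟨q, hdis, h⟩
      choose x hx hp using h
      have hinj : Function.Injective x := by
        intro i i' h
        by_contra hne
        exact Set.disjoint_left.1 (hdis i i' hne) (hx i).2 (h ▸ (hx i').2)
      have hr : range x ⊆ {x | x ∈ I ∧ ev p x = 0} := by
        rintro _ ⟨i, rfl⟩; exact ⟨(hx i).1, hp i⟩
      refine le_trans ?_ (Set.encard_le_encard hr)
      rw [← Set.image_univ, hinj.encard_image]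
      simp
  rw [e]
  refine MeasurableSet.iUnion fun q => MeasurableSet.iUnion fun _ => MeasurableSet.iInter fun i => ?_
  exact meas_root _ (hI.inter ordConnected_Icc)

theorem meas_nI {n : ℕ} (I : Set ℝ) (hI : I.OrdConnected) :
    Measurable (fun p : Fin n → ℝ => (nI I p : ℝ)) := by
  have h1 : Measurable (fun p : Fin n → ℝ => ({x | x ∈ I ∧ ev p x = 0} : Set ℝ).encard) := by
    rw [ENat.measurable_iff]
    intro j
    have : (fun p : Fin n → ℝ => ({x | x ∈ I ∧ ev p x = 0} : Set ℝ).encard) ⁻¹' {(j : ℕ∞)} =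
      {p : Fin n → ℝ | (j : ℕ∞) ≤ ({x | x ∈ I ∧ ev p x = 0} : Set ℝ).encard} \
      {p : Fin n → ℝ | ((j + 1 : ℕ) : ℕ∞) ≤ ({x | x ∈ I ∧ ev p x = 0} : Set ℝ).encard} := by
      ext p
      simp only [mem_preimage, mem_singleton_iff, mem_sdiff, mem_ofPred_eq]
      generalize ({x | x ∈ I ∧ ev p x = 0} : Set ℝ).encard = N
      cases N with
      | top => simp
      | coe N => norm_cast; omega
    rw [this]
    exact (meas_le_encard I hI j).diff (meas_le_encard I hI (j+1))
  have h2 : Measurable (fun N : ℕ∞ => ((N.toNat : ℕ) : ℝ)) := measurable_from_top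
  exact h2.comp h1

/-! lattice sum vs integral -/

theorem muT_singleton (T : ℝ) (hT : 0 < T) (x : ℝ) (hx : x ∈ sbox T) : (muT T).real {x} = 1 / T := by
  unfold muT
  rw [measureReal_ennreal_smul_apply, ENNReal.toReal_ofReal (by positivity),
    measureReal_restrict_apply (measurableSet_singleton _),
    Set.inter_eq_left.2 (by simpa using hx), Measure.real, Measure.count_singleton]
  simp

theorem muT_pi_restrict (T : ℝ) (n : ℕ) :
    (Measure.pi fun _ : Fin n => muT T).restrict ((Fintype.piFinset fun _ => sbox T : Finset (Fin n → ℝ)) : Set (Fin n → ℝ))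
      = Measure.pi fun _ : Fin n => muT T := by
  rw [Fintype.coe_piFinset, Measure.restrict_pi_pi]
  congr 1
  ext1 i
  unfold muT
  rw [Measure.restrict_smul, Measure.restrict_restrict (Finset.measurableSet _), Set.inter_self]

theorem integral_muT_pi (T : ℝ) (hT : 0 < T) (n : ℕ) (f : (Fin n → ℝ) → ℝ) :
    ∫ p, f p ∂(Measure.pi fun _ : Fin n => muT T)
      = (∑ a ∈ Fintype.piFinset fun _ : Fin n => zbox T, f (fun i => (a i : ℝ) / T)) / T ^ n := by
  rw [← muT_pi_restrict, setIntegral_finset _ IntegrableOn.finset]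
  have h1 : ∀ x ∈ (Fintype.piFinset fun _ : Fin n => sbox T),
      (Measure.pi fun _ : Fin n => muT T).real {x} • f x = f x / T ^ n := by
    intro x hx
    rw [Fintype.mem_piFinset] at hx
    have : (Measure.pi fun _ : Fin n => muT T).real {x} = (1 / T) ^ n := by
      rw [Measure.real, Measure.pi_singleton, ENNReal.toReal_prod]
      have : ∀ i, ((muT T) {x i}).toReal = 1 / T := fun i => muT_singleton T hT _ (hx i)
      simp [this]
    rw [this, smul_eq_mul]; simp; ring
  rw [Finset.sum_congr rfl h1, ← Finset.sum_div]
  congr 1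
  symm
  refine Finset.sum_bij (fun a _ => fun i => (a i : ℝ) / T) ?_ ?_ ?_ ?_
  · intro a ha
    rw [Fintype.mem_piFinset] at ha ⊢
    intro i
    exact Finset.mem_image_of_mem _ (ha i)
  · intro a _ b _ h
    ext i
    have := congrFun h i
    have := (div_left_inj' hT.ne').1 this
    exact_mod_cast this
  · intro x hx
    rw [Fintype.mem_piFinset] at hx
    have : ∀ i, ∃ a ∈ zbox T, (a : ℝ) / T = x i := fun i => by
      have := hx i
      rw [sbox, Finset.mem_image] at this
      exact this
    choose a ha hax using this
    exact ⟨a, Fintype.mem_piFinset.2 ha, funext hax⟩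
  · intro a _; rfl

theorem nI_smul {n : ℕ} (I : Set ℝ) (p : Fin n → ℝ) (c : ℝ) (hc : c ≠ 0) :
    nI I (fun i => c * p i) = nI I p := by
  have : ∀ x, ev (fun i => c * p i) x = c * ev p x := by
    intro x; simp only [ev, Finset.mul_sum, mul_assoc]
  unfold nI
  simp_rw [this, mul_eq_zero, hc, false_or]

def Vol (I : Set ℝ) (d : ℕ) : ℝ := ∫ p, (nI I p : ℝ) ∂(Measure.pi fun _ : Fin (d+1) => nu1)

def zpoly (T : ℝ) (d : ℕ) : Finset (Fin (d+1) → ℤ) := Fintype.piFinset fun _ => zbox T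

def nZ (I : Set ℝ) {n : ℕ} (a : Fin n → ℤ) : ℕ := nI I (fun i => (a i : ℝ))

theorem lattice_count (d : ℕ) (hd : 1 ≤ d) (I : Set ℝ) (hI : I.OrdConnected) (T : ℝ) (hT : 1 ≤ T) :
    |(∑ a ∈ zpoly T d, (nZ I a : ℝ)) - Vol I d * T ^ (d+1)|
      ≤ (d + 1) * 3 ^ (d+1) * (2 * d + 5) * T ^ d := by
  have hT0 : 0 < T := by linarith
  have h := hybrid (muT T) nu1 3 ((2 * d + 5) / T) d (by norm_num) (muT_mass T hT) nu1_mass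
    (by positivity) (d+1) (fun p => (nI I p : ℝ)) (meas_nI I hI)
    (fun p => by rw [Nat.abs_cast]; exact_mod_cast nI_le hd I hI p)
    (fun p i => section_bound d I hI T hT0 p i)
  rw [integral_muT_pi T hT0] at h
  have e : ∀ a : Fin (d+1) → ℤ, nI I (fun i => (a i : ℝ) / T) = nZ I a := by
    intro a
    rw [nZ, ← nI_smul I (fun i => (a i : ℝ)) (1/T) (by positivity)]
    congr 1; ext i; ring
  simp_rw [e] at h
  change |(∑ a ∈ zpoly T d, (nZ I a : ℝ)) / T ^ (d+1) - Vol I d| ≤ _ at h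
  set S := ∑ a ∈ zpoly T d, (nZ I a : ℝ)
  have e2 : S - Vol I d * T ^ (d+1) = (S / T ^ (d+1) - Vol I d) * T ^ (d+1) := by
    field_simp
  rw [e2, abs_mul, abs_of_pos (by positivity : (0:ℝ) < T ^ (d+1))]
  refine (mul_le_mul_of_nonneg_right h (by positivity)).trans (le_of_eq ?_)
  push_cast
  field_simp
  ring

theorem Vol_bounds (d : ℕ) (hd : 1 ≤ d) (I : Set ℝ) (hI : I.OrdConnected) :
    0 ≤ Vol I d ∧ Vol I d ≤ d * 3 ^ (d+1) := by
  refine ⟨integral_nonneg fun p => by positivity, ?_⟩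
  refine (le_abs_self _).trans ?_
  refine abs_integral_le _ _ _ _ (by positivity) ?_ (fun p => ?_)
  · rw [pi_real_univ]
    exact pow_le_pow_left₀ measureReal_nonneg nu1_mass _
  · rw [Nat.abs_cast]; exact_mod_cast nI_le hd I hI p

end KL

namespace KL
open scoped ENNReal

def Wf {d : ℕ} (q : Fin d → ℝ) (x : ℝ) : ℝ := ∑ k : Fin d, q k * x ^ ((k : ℕ) + 1)
def Wd {d : ℕ} (q : Fin d → ℝ) (x : ℝ) : ℝ := ∑ k : Fin d, (((k : ℕ) : ℝ) + 1) * q k * x ^ (k : ℕ)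

theorem ev_cons {d : ℕ} (t : ℝ) (q : Fin d → ℝ) (x : ℝ) :
    ev (Fin.cons t q : Fin (d+1) → ℝ) x = t + Wf q x := by
  simp [ev, Fin.sum_univ_succ, Wf]

theorem hasDeriv_Wf {d : ℕ} (q : Fin d → ℝ) (x : ℝ) : HasDerivAt (Wf q) (Wd q x) x := by
  unfold Wd
  have : HasDerivAt (fun x => ∑ k : Fin d, q k * x ^ ((k : ℕ) + 1))
      (∑ k : Fin d, q k * ((((k : ℕ) + 1 : ℕ) : ℝ) * x ^ (k : ℕ))) x := by
    apply HasDerivAt.fun_sum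
    intro k _
    simpa using (hasDerivAt_pow ((k:ℕ)+1) x).const_mul (q k)
  have e : (∑ k : Fin d, (((k : ℕ) : ℝ) + 1) * q k * x ^ (k : ℕ))
      = ∑ k : Fin d, q k * ((((k : ℕ) + 1 : ℕ) : ℝ) * x ^ (k : ℕ)) := by
    refine Finset.sum_congr rfl fun k _ => ?_
    push_cast; ring
  rw [e]
  exact this

def Ff {d : ℕ} (q : Fin d → ℝ) (x : ℝ) : ℝ := ({q | |Wf q x| ≤ 1} : Set (Fin d → ℝ)).indicator (fun q => |Wd q x|) q

theorem Ff_nonneg {d : ℕ} (q : Fin d → ℝ) (x : ℝ) : 0 ≤ Ff q x :=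
  indicator_nonneg (fun _ _ => abs_nonneg _) _

theorem meas_Ff {d : ℕ} : Measurable (fun z : (Fin d → ℝ) × ℝ => Ff z.1 z.2) := by
  have h1 : Measurable (fun z : (Fin d → ℝ) × ℝ => |Wd z.1 z.2|) := by unfold Wd; fun_prop
  have h2 : Measurable (fun z : (Fin d → ℝ) × ℝ => |Wf z.1 z.2|) := by unfold Wf; fun_prop
  have h3 : MeasurableSet {z : (Fin d → ℝ) × ℝ | |Wf z.1 z.2| ≤ 1} := measurableSet_le h2 measurable_const
  exact h1.indicator h3

theorem ofReal_Ff {d : ℕ} (q : Fin d → ℝ) (x : ℝ) :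
    ENNReal.ofReal (Ff q x) = ENNReal.ofReal |Wd q x| * (Icc (-1:ℝ) 1).indicator 1 (- Wf q x) := by
  unfold Ff
  by_cases h : |Wf q x| ≤ 1
  · rw [indicator_of_mem (by exact h), indicator_of_mem]
    · simp
    · rw [abs_le] at h; constructor <;> linarith
  · rw [indicator_of_notMem (by exact h), indicator_of_notMem]
    · simp
    · intro h2
      apply h
      rw [abs_le]
      exact ⟨by linarith [h2.2], by linarith [h2.1]⟩

open Classical in
theorem inner_lint {d : ℕ} (I : Set ℝ) (hI : I.OrdConnected) (q : Fin d → ℝ) :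
    ∫⁻ t, (nI I (Fin.cons t q : Fin (d+1) → ℝ) : ℝ≥0∞) ∂nu1 = ∫⁻ x in I, ENNReal.ofReal (Ff q x) := by
  by_cases hq0 : q = 0
  · have hW : ∀ x, Wf q x = 0 := by intro x; simp [hq0, Wf]
    have hW' : ∀ x, Wd q x = 0 := by intro x; simp [hq0, Wd]
    simp_rw [ofReal_Ff, hW']
    simp only [abs_zero, ENNReal.ofReal_zero, zero_mul, lintegral_zero]
    rw [lintegral_eq_zero_iff']
    · have : ∀ᵐ t ∂nu1, t ≠ 0 := by
        unfold nu1
        refine ae_restrict_of_ae ?_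
        exact Measure.ae_ne volume 0
      filter_upwards [this] with t ht
      have : ({x | x ∈ I ∧ ev (Fin.cons t q : Fin (d+1) → ℝ) x = 0} : Set ℝ) = ∅ := by
        ext x; simp [ev_cons, hW, ht]
      simp [nI, this]
    · have h1 := (meas_nI (n := d+1) I hI).comp ((meas_cons d).comp (measurable_prodMk_right (y := q)))
      have h2 := ENNReal.measurable_ofReal.comp h1
      simpa [Function.comp_def] using h2.aemeasurable
  set q' : Fin (d+1) → ℝ := Fin.cons 0 q with hq'
  have hev : ∀ t x, ev (Fin.cons t q : Fin (d+1) → ℝ) x = ev q' x + t * x ^ 0 := by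
    intro t x; rw [hq', ev_cons, ev_cons]; ring
  have hWev : ∀ x, ev q' x = Wf q x := by intro x; rw [hq', ev_cons]; ring
  have hq'0 : q' ≠ 0 := by
    intro h
    apply hq0
    ext i
    simpa [hq'] using congrFun h i.succ
  have hRne : critR q' 0 ≠ 0 := critR_ne q' (0 : Fin (d+1)) (by simp [hq']) hq'0
  set Z : Finset ℝ := insert 0 (critR q' 0).roots.toFinset with hZ
  have h0c : ∀ m, (0:ℝ) ∉ cell I Z m := fun m h => h.2.1 (by simp [hZ])
  have hRc : ∀ m, ∀ x ∈ cell I Z m, (critR q' 0).eval x ≠ 0 :=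
    fun m x hx h => hx.2.1 (by simp [hZ, hRne, h])
  have hJ := fun m => cell_count q' 0 (cell I Z m) (cell_ord I hI Z m) (h0c m) (hRc m)
  have hG := fun m => g_inj q' 0 (cell I Z m) (cell_ord I hI Z m) (h0c m) (hRc m)
  have hg : (fun x => - ev q' x / x ^ 0) = fun x => - Wf q x := by
    ext x; rw [hWev]; simp
  rw [hg] at hJ hG
  have hcount : ∀ t, (nI I (Fin.cons t q : Fin (d+1) → ℝ) : ℝ≥0∞)
      = (∑ z ∈ Z, ({t | z ∈ I ∧ t = - Wf q z} : Set ℝ).indicator 1 t)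
        + ∑ m ∈ Finset.range (Z.card + 1), ((fun x => - Wf q x) '' (cell I Z m)).indicator 1 t := by
    intro t
    have hp0 : (Fin.cons t q : Fin (d+1) → ℝ) ≠ 0 := by
      intro h
      apply hq0
      ext i
      simpa using congrFun h i.succ
    have hset : ({x | x ∈ I ∧ ev (Fin.cons t q : Fin (d+1) → ℝ) x = 0} : Set ℝ)
        = I ∩ {x | ev q' x + t * x ^ 0 = 0} := by
      ext x; simp only [mem_ofPred_eq, mem_inter_iff, hev]
    have hfin := rts_finite I _ hp0
    rw [hset] at hfin
    have := count_decomp I {x | ev q' x + t * x ^ 0 = 0} Z hfin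
    rw [nI, hset, this]
    push_cast
    congr 1
    · refine Finset.sum_congr rfl fun z _ => ?_
      simp only [indicator, mem_inter_iff, mem_ofPred_eq, Pi.one_apply, hWev, pow_zero, mul_one]
      have : (Wf q z + t = 0) ↔ t = - Wf q z := by
        constructor <;> intro h <;> linarith
      simp only [this]
    · refine Finset.sum_congr rfl fun m _ => ?_
      have h := (hJ m).2 t
      by_cases ht : t ∈ (fun x => - Wf q x) '' (cell I Z m)
      · rw [indicator_of_mem ht] at h ⊢
        simp only [Pi.one_apply] at h ⊢
        exact_mod_cast h
      · rw [indicator_of_notMem ht] at h ⊢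
        exact_mod_cast h
  have hmS : ∀ z ∈ Z, MeasurableSet ({t | z ∈ I ∧ t = - Wf q z} : Set ℝ) := by
    intro z _
    exact (Set.Subsingleton.measurableSet fun a ha b hb => ha.2.trans hb.2.symm)
  have hmI : ∀ m, MeasurableSet ((fun x => - Wf q x) '' (cell I Z m)) := fun m => (hJ m).1.measurableSet
  simp_rw [hcount]
  rw [lintegral_add_left, lintegral_finsetSum, lintegral_finsetSum]
  rotate_left
  · exact fun m _ => measurable_one.indicator (hmI m)
  · exact fun z hz => measurable_one.indicator (hmS z hz)
  · exact Finset.measurable_sum _ fun z hz => measurable_one.indicator (hmS z hz)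
  have hz0 : ∑ z ∈ Z, ∫⁻ t, ({t | z ∈ I ∧ t = - Wf q z} : Set ℝ).indicator 1 t ∂nu1 = 0 := by
    refine Finset.sum_eq_zero fun z hz => ?_
    rw [lintegral_indicator_one (hmS z hz)]
    have hle : ({t | z ∈ I ∧ t = - Wf q z} : Set ℝ) ⊆ {- Wf q z} := fun t ht => ht.2
    refine measure_mono_null hle ?_
    unfold nu1
    exact le_antisymm ((Measure.restrict_apply_le _ _).trans (by simp)) (zero_le)
  rw [hz0, zero_add]
  have hIZ : ∫⁻ x in I, ENNReal.ofReal (Ff q x)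
      = ∫⁻ x in ⋃ m ∈ Finset.range (Z.card + 1), cell I Z m, ENNReal.ofReal (Ff q x) := by
    apply setLIntegral_congr
    have hs : (⋃ m ∈ Finset.range (Z.card + 1), cell I Z m) = I \ (Z : Set ℝ) := by
      ext x
      simp only [mem_iUnion, Finset.mem_range, mem_sdiff, cell, mem_ofPred_eq, Finset.mem_coe]
      constructor
      · rintro ⟨m, _, h1, h2, _⟩; exact ⟨h1, h2⟩
      · rintro ⟨h1, h2⟩
        exact ⟨_, Nat.lt_succ_of_le (Finset.card_filter_le _ _), h1, h2, rfl⟩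
    rw [hs]
    exact (sdiff_null_ae_eq_self (Finset.measure_zero Z volume)).symm
  rw [hIZ, lintegral_biUnion_finset]
  rotate_left
  · intro m _ m' _ hmm
    refine Set.disjoint_left.2 fun x hx hx' => hmm ?_
    exact hx.2.2.symm.trans hx'.2.2
  · exact fun m _ => (cell_ord I hI Z m).measurableSet
  refine Finset.sum_congr rfl fun m _ => ?_
  rw [lintegral_indicator_one (hmI m)]
  have hcv := lintegral_image_eq_lintegral_abs_deriv_mul (s := cell I Z m) (f := fun x => - Wf q x)
    (f' := fun x => - Wd q x) (cell_ord I hI Z m).measurableSet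
    (fun x _ => (hasDeriv_Wf q x).neg.hasDerivWithinAt) (hG m).2
    ((Icc (-1:ℝ) 1).indicator 1)
  simp_rw [ofReal_Ff]
  simp only [abs_neg] at hcv
  rw [← hcv, lintegral_indicator_one measurableSet_Icc, nu1, Measure.restrict_apply (hmI m),
    Measure.restrict_apply measurableSet_Icc, inter_comm]

theorem pi_nu1 (d : ℕ) : (Measure.pi fun _ : Fin d => nu1) =
    volume.restrict (univ.pi fun _ : Fin d => Icc (-1:ℝ) 1) := by
  unfold nu1
  rw [volume_pi, Measure.restrict_pi_pi]

theorem rho_eq (d : ℕ) (x : ℝ) : rho d x = ∫ q, Ff q x ∂(Measure.pi fun _ : Fin d => nu1) := by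
  rw [pi_nu1]
  unfold Ff
  have hm : MeasurableSet {q : Fin d → ℝ | |Wf q x| ≤ 1} := by
    refine measurableSet_le ?_ measurable_const
    unfold Wf; fun_prop
  rw [setIntegral_indicator hm, rho]
  congr 2
  ext p
  simp only [DeltaDom, mem_ofPred_eq, mem_inter_iff, mem_pi, mem_univ, true_imp_iff, abs_le, mem_Icc, Wf]

theorem Ff_integrable (d : ℕ) (hd : 1 ≤ d) (I : Set ℝ) (hI : I.OrdConnected) :
    Integrable (fun z : (Fin d → ℝ) × ℝ => Ff z.1 z.2)
      ((Measure.pi fun _ : Fin d => nu1).prod (volume.restrict I)) := by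
  refine ⟨meas_Ff.aestronglyMeasurable, ?_⟩
  rw [hasFiniteIntegral_iff_ofReal (Filter.Eventually.of_forall fun z => Ff_nonneg _ _)]
  rw [lintegral_prod _ (meas_Ff.ennreal_ofReal.aemeasurable)]
  simp_rw [← inner_lint I hI]
  calc ∫⁻ q : Fin d → ℝ, ∫⁻ t, (nI I (Fin.cons t q : Fin (d+1) → ℝ) : ℝ≥0∞) ∂nu1 ∂(Measure.pi fun _ => nu1)
      ≤ ∫⁻ q : Fin d → ℝ, ∫⁻ t, (d : ℝ≥0∞) ∂nu1 ∂(Measure.pi fun _ => nu1) := by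
        refine lintegral_mono fun q => lintegral_mono fun t => ?_
        exact Nat.cast_le.2 (nI_le hd I hI _)
    _ < ⊤ := by
        simp only [lintegral_const]
        refine ENNReal.mul_lt_top (ENNReal.mul_lt_top ?_ (measure_lt_top _ _)) (measure_lt_top _ _)
        exact ENNReal.natCast_lt_top d

theorem Vol_eq (d : ℕ) (hd : 1 ≤ d) (I : Set ℝ) (hI : I.OrdConnected) :
    Vol I d = ∫ x in I, rho d x := by
  have hm : Measurable (fun z : ℝ × (Fin d → ℝ) => (nI I (Fin.cons z.1 z.2 : Fin (d+1) → ℝ) : ℝ)) :=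
    (meas_nI I hI).comp (meas_cons d)
  rw [Vol, integral_pi_succ, integral_prod_symm]
  swap
  · exact bdd_integrable _ _ hm d (fun z => by rw [Nat.abs_cast]; exact_mod_cast nI_le hd I hI _)
  simp_rw [rho_eq]
  have hsw := integral_integral_swap (f := fun (q : Fin d → ℝ) (x : ℝ) => Ff q x) (Ff_integrable d hd I hI)
  rw [← hsw]
  refine integral_congr_ae (Filter.Eventually.of_forall fun q => ?_)
  simp only
  rw [integral_eq_lintegral_of_nonneg_ae, integral_eq_lintegral_of_nonneg_ae, ← inner_lint I hI q]
  · simp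
  · exact Filter.Eventually.of_forall fun x => Ff_nonneg q x
  · exact (meas_Ff.comp measurable_prodMk_left).aestronglyMeasurable
  · exact Filter.Eventually.of_forall fun x => by positivity
  · exact (hm.comp measurable_prodMk_right).aestronglyMeasurable

end KL

namespace KL

theorem zeta_summable (D : ℕ) (hD : 2 ≤ D) : Summable (fun n : ℕ => (1:ℝ) / ((n:ℝ)+1)^D) := by
  have := (summable_nat_add_iff 1).2 (Real.summable_one_div_nat_pow.2 (by omega : 1 < D))
  simpa using this

theorem one_le_zetaR (D : ℕ) (hD : 2 ≤ D) : 1 ≤ zetaR D := by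
  unfold zetaR
  have := (zeta_summable D hD).le_tsum 0 (fun n _ => by positivity)
  simpa using this

theorem sum_sq_le (N : ℕ) : ∑ n ∈ Finset.range (N+1), (1:ℝ) / ((n:ℝ)+2)^2 ≤ 3/4 - 1/((N:ℝ)+2) := by
  induction N with
  | zero => norm_num
  | succ N ih =>
    rw [Finset.sum_range_succ]
    push_cast
    have h : (1:ℝ) / ((N:ℝ)+1+2)^2 ≤ 1/((N:ℝ)+2) - 1/((N:ℝ)+1+2) := by
      rw [div_sub_div _ _ (by positivity) (by positivity), div_le_div_iff₀ (by positivity) (by positivity)]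
      nlinarith [(by positivity : (0:ℝ) ≤ N)]
    linarith

theorem sum_pow_le (d N : ℕ) (hd : 2 ≤ d) : ∑ n ∈ Finset.range N, (1:ℝ) / ((n:ℝ)+2)^d ≤ 3/4 := by
  have h1 : ∑ n ∈ Finset.range N, (1:ℝ) / ((n:ℝ)+2)^d ≤ ∑ n ∈ Finset.range (N+1), (1:ℝ) / ((n:ℝ)+2)^2 := by
    refine (Finset.sum_le_sum fun n _ => ?_).trans
      (Finset.sum_le_sum_of_subset_of_nonneg (Finset.range_mono (Nat.le_succ N)) fun n _ _ => by positivity)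
    apply one_div_le_one_div_of_le (by positivity)
    exact pow_le_pow_right₀ (by linarith [(by positivity : (0:ℝ) ≤ n)]) hd
  have := sum_sq_le N
  have : 0 ≤ 1/((N:ℝ)+2) := by positivity
  linarith

theorem contraction (d : ℕ) (hd : 2 ≤ d) (A P : ℝ → ℝ) (V C : ℝ) (hV : 0 ≤ V) (hVC : V ≤ C)
    (h1 : ∀ T, 0 < T → |A T - V * T ^ (d+1)| ≤ C * T ^ d)
    (h2 : ∀ T : ℝ, 0 < T → ∀ N : ℕ, T ≤ N → A T = ∑ n ∈ Finset.range N, P (T / ((n:ℝ)+1)))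
    (h3 : ∀ T, 0 < T → T < 1 → P T = 0) (m : ℕ) :
    ∀ T, 0 < T → T < 2 ^ m → |P T - V / zetaR (d+1) * T ^ (d+1)| ≤ 4 * C * T ^ d := by
  have hz := one_le_zetaR (d+1) (by omega)
  set w := V / zetaR (d+1) with hw
  have hw0 : 0 ≤ w := div_nonneg hV (by linarith)
  have hwV : w ≤ V := div_le_self hV hz
  induction m with
  | zero =>
    intro T hT hT1
    simp only [pow_zero] at hT1
    rw [h3 T hT hT1, zero_sub, abs_neg, abs_of_nonneg (by positivity)]
    have : T ^ (d+1) ≤ T ^ d := pow_le_pow_of_le_one hT.le hT1.le (Nat.le_succ d)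
    have e1 : w * T ^ (d+1) ≤ C * T ^ d := mul_le_mul (hwV.trans hVC) this (by positivity) (by linarith)
    have : 0 ≤ C * T ^ d := mul_nonneg (by linarith) (by positivity)
    linarith
  | succ m ih =>
    intro T hT hT1
    have hsum := (zeta_summable (d+1) (by omega)).hasSum.tendsto_sum_nat
    change Filter.Tendsto _ _ (nhds (zetaR (d+1))) at hsum
    have hlim : Filter.Tendsto (fun N : ℕ => 4 * C * T ^ d +
        w * T ^ (d+1) * |zetaR (d+1) - ∑ n ∈ Finset.range N, (1:ℝ) / ((n:ℝ)+1)^(d+1)|)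
        Filter.atTop (nhds (4 * C * T ^ d + w * T ^ (d+1) * |zetaR (d+1) - zetaR (d+1)|)) :=
      tendsto_const_nhds.add (tendsto_const_nhds.mul (tendsto_const_nhds.sub hsum).abs)
    have hlim' : 4 * C * T ^ d + w * T ^ (d+1) * |zetaR (d+1) - zetaR (d+1)| = 4 * C * T ^ d := by simp
    rw [hlim'] at hlim
    refine ge_of_tendsto hlim ?_
    filter_upwards [Filter.eventually_ge_atTop (⌈T⌉₊ + 1)] with N hN
    obtain ⟨N, rfl⟩ : ∃ M, N = M + 1 := ⟨N - 1, by omega⟩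
    have hTN : T ≤ ((N + 1 : ℕ) : ℝ) := (Nat.le_ceil T).trans (by exact_mod_cast (by omega))
    have hA := h2 T hT (N+1) hTN
    have hAe := h1 T hT
    set r := zetaR (d+1) - ∑ n ∈ Finset.range (N+1), (1:ℝ) / ((n:ℝ)+1)^(d+1) with hr
    have hVw : V = w * zetaR (d+1) := by rw [hw]; field_simp
    have hsplit : ∑ n ∈ Finset.range (N+1), (P (T / ((n:ℝ)+1)) - w * (T / ((n:ℝ)+1))^(d+1))
        = A T - w * T ^ (d+1) * (zetaR (d+1) - r) := by
      rw [Finset.sum_sub_distrib, ← hA, hr, sub_sub_cancel, Finset.mul_sum]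
      congr 1
      refine Finset.sum_congr rfl fun n _ => ?_
      rw [div_pow]; ring
    rw [Finset.sum_range_succ'] at hsplit
    simp only [Nat.cast_zero, zero_add, div_one] at hsplit
    have hrest : |∑ n ∈ Finset.range N, (P (T / (((n+1:ℕ):ℝ)+1)) - w * (T / (((n+1:ℕ):ℝ)+1))^(d+1))|
        ≤ 3 * C * T ^ d := by
      refine (Finset.abs_sum_le_sum_abs _ _).trans ?_
      have hb : ∀ n ∈ Finset.range N, |P (T / (((n+1:ℕ):ℝ)+1)) - w * (T / (((n+1:ℕ):ℝ)+1))^(d+1)|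
          ≤ 4 * C * T ^ d * ((1:ℝ) / ((n:ℝ)+2)^d) := by
        intro n _
        have e : (((n+1:ℕ):ℝ)+1) = (n:ℝ) + 2 := by push_cast; ring
        rw [e]
        refine (ih (T / ((n:ℝ)+2)) (by positivity) ?_).trans (le_of_eq ?_)
        · rw [div_lt_iff₀ (by positivity)]
          rw [pow_succ] at hT1
          have : (2:ℝ)^m * 2 ≤ 2 ^ m * ((n:ℝ)+2) :=
            mul_le_mul_of_nonneg_left (by linarith [(by positivity : (0:ℝ) ≤ n)]) (by positivity)
          linarith
        · rw [div_pow]; ring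
      refine (Finset.sum_le_sum hb).trans ?_
      rw [← Finset.mul_sum]
      have h4 : 0 ≤ 4 * C * T ^ d := mul_nonneg (by linarith) (by positivity)
      have := mul_le_mul_of_nonneg_left (sum_pow_le d N hd) h4
      linarith
    have hfin : P T - w * T ^ (d+1) = (A T - V * T ^ (d+1)) -
        (∑ n ∈ Finset.range N, (P (T / (((n+1:ℕ):ℝ)+1)) - w * (T / (((n+1:ℕ):ℝ)+1))^(d+1)))
        + w * T ^ (d+1) * r := by
      linear_combination hsplit + T ^ (d+1) * hVw
    rw [hfin]
    refine (abs_add_le _ _).trans ?_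
    have hlast : |w * T ^ (d+1) * r| = w * T ^ (d+1) * |r| := by
      rw [abs_mul, abs_of_nonneg (by positivity)]
    rw [hlast]
    have := abs_sub (A T - V * T ^ (d+1)) (∑ n ∈ Finset.range N, (P (T / (((n+1:ℕ):ℝ)+1)) - w * (T / (((n+1:ℕ):ℝ)+1))^(d+1)))
    linarith

def Nall (I : Set ℝ) (d : ℕ) (T : ℝ) : ℝ := ∑ a ∈ (zpoly T d).filter (· ≠ 0), (nZ I a : ℝ)

def Nprim (I : Set ℝ) (d : ℕ) (T : ℝ) : ℝ :=
  ∑ a ∈ (zpoly T d).filter (fun a => Finset.univ.gcd a = 1), (nZ I a : ℝ)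

theorem mem_zpoly {T : ℝ} {d : ℕ} {a : Fin (d+1) → ℤ} : a ∈ zpoly T d ↔ ∀ i, |(a i : ℝ)| ≤ T := by
  simp [zpoly, Fintype.mem_piFinset, mem_zbox]

theorem zpoly_lt_one {T : ℝ} (hT : T < 1) {d : ℕ} {a : Fin (d+1) → ℤ} (ha : a ∈ zpoly T d) : a = 0 := by
  ext i
  have := mem_zpoly.1 ha i
  have h2 : |(a i : ℝ)| < 1 := by linarith
  have h3 : |a i| < 1 := by exact_mod_cast h2
  simpa using Int.abs_lt_one_iff.1 h3

theorem nZ_smul (I : Set ℝ) {d : ℕ} (a : Fin d → ℤ) (n : ℤ) (hn : n ≠ 0) :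
    nZ I (fun i => n * a i) = nZ I a := by
  unfold nZ
  rw [← nI_smul I (fun i => (a i : ℝ)) (n : ℝ) (by exact_mod_cast hn)]
  push_cast; rfl

theorem Nall_eq (I : Set ℝ) (d : ℕ) (T : ℝ) (hT : 0 < T) (N : ℕ) (hN : T ≤ N) :
    Nall I d T = ∑ n ∈ Finset.range N, Nprim I d (T / ((n:ℝ)+1)) := by
  unfold Nall Nprim
  rw [← Finset.sum_fiberwise_of_maps_to (g := fun a : Fin (d+1) → ℤ => (Finset.univ.gcd a).natAbs - 1)
    (t := Finset.range N)]
  · refine Finset.sum_congr rfl fun n _ => ?_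
    symm
    refine Finset.sum_bij (fun a _ => fun i => ((n:ℤ)+1) * a i) ?_ ?_ ?_ ?_
    · intro a ha
      simp only [Finset.mem_filter, mem_zpoly] at ha ⊢
      obtain ⟨h1, h2⟩ := ha
      have hg : Finset.univ.gcd (fun i => ((n:ℤ)+1) * a i) = (n:ℤ)+1 := by
        rw [Finset.gcd_mul_left, h2, mul_one]
        exact Int.normalize_of_nonneg (by positivity)
      refine ⟨⟨fun i => ?_, ?_⟩, ?_⟩
      · have := h1 i
        rw [le_div_iff₀ (by positivity)] at this
        push_cast
        rw [abs_mul, abs_of_pos (by positivity : (0:ℝ) < (n:ℝ)+1)]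
        linarith
      · intro h0
        rw [h0] at hg
        have : Finset.univ.gcd (0 : Fin (d+1) → ℤ) = 0 := Finset.gcd_eq_zero_iff.2 (by simp)
        omega
      · rw [hg]; omega
    · intro a _ b _ h
      ext i
      have := congrFun h i
      exact mul_left_cancel₀ (by positivity) this
    · intro b hb
      simp only [Finset.mem_filter, mem_zpoly] at hb
      obtain ⟨⟨h1, h2⟩, h3⟩ := hb
      have hg0 : Finset.univ.gcd b ≠ 0 := by
        intro h
        apply h2
        rw [Finset.gcd_eq_zero_iff] at h
        ext i; exact h i (Finset.mem_univ _)
      have hgnn : 0 ≤ Finset.univ.gcd b := by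
        have := Finset.normalize_gcd (s := Finset.univ) (f := b)
        rw [← this]
        exact Int.nonneg_of_normalize_eq_self (by simp)
      have hg : Finset.univ.gcd b = (n:ℤ)+1 := by omega
      have hdvd : ∀ i, ((n:ℤ)+1) ∣ b i := fun i => hg ▸ Finset.gcd_dvd (Finset.mem_univ i)
      choose a ha using hdvd
      have hba : b = fun i => ((n:ℤ)+1) * a i := funext ha
      refine ⟨a, ?_, hba.symm⟩
      simp only [Finset.mem_filter, mem_zpoly]
      constructor
      · intro i
        have := h1 i
        rw [ha i] at this
        push_cast at this
        rw [abs_mul, abs_of_pos (by positivity : (0:ℝ) < (n:ℝ)+1)] at this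
        rw [le_div_iff₀ (by positivity)]; linarith
      · rw [hba, Finset.gcd_mul_left, Int.normalize_of_nonneg (by positivity)] at hg
        have hpos : ((n:ℤ)+1) ≠ 0 := by positivity
        exact mul_left_cancel₀ hpos (by rw [hg, mul_one])
    · intro a _
      rw [nZ_smul I a _ (by positivity)]
  · intro a ha
    simp only [Finset.mem_filter, mem_zpoly] at ha
    obtain ⟨h1, h2⟩ := ha
    obtain ⟨i, hi⟩ := Function.ne_iff.1 h2
    simp only [Pi.zero_apply] at hi
    have hdvd : Finset.univ.gcd a ∣ a i := Finset.gcd_dvd (Finset.mem_univ i)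
    have hle := Nat.le_of_dvd (Int.natAbs_pos.2 hi) (Int.natAbs_dvd_natAbs.2 hdvd)
    have hb := (h1 i).trans hN
    have : |a i| ≤ N := by exact_mod_cast hb
    rw [Finset.mem_range]
    have hN0 : 0 < N := by
      have : (0:ℝ) < N := by linarith
      exact_mod_cast this
    rw [abs_le] at this
    omega

def C1 (d : ℕ) : ℝ := (d + 1) * 3 ^ (d+1) * (2 * d + 7)

theorem Nall_bound (d : ℕ) (hd : 1 ≤ d) (I : Set ℝ) (hI : I.OrdConnected) (T : ℝ) (hT : 0 < T) :
    |Nall I d T - Vol I d * T ^ (d+1)| ≤ C1 d * T ^ d := by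
  obtain ⟨hV0, hV1⟩ := Vol_bounds d hd I hI
  have h3 : (1:ℝ) ≤ 3 ^ (d+1) := one_le_pow₀ (by norm_num)
  have hd0 : (0:ℝ) ≤ d := by positivity
  have hd3 : (0:ℝ) ≤ d * 3 ^ (d+1) := by positivity
  by_cases h1 : 1 ≤ T
  · have hb := lattice_count d hd I hI T h1
    have hs : ∑ a ∈ zpoly T d, (nZ I a : ℝ) = nZ I (0 : Fin (d+1) → ℤ) + Nall I d T := by
      have hmem : (0 : Fin (d+1) → ℤ) ∈ zpoly T d := by
        rw [mem_zpoly]; intro i; simp; linarith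
      rw [Nall, Finset.filter_ne']
      exact (Finset.add_sum_erase (zpoly T d) (fun a => (nZ I a : ℝ)) hmem).symm
    have h0 : (nZ I (0 : Fin (d+1) → ℤ) : ℝ) ≤ d := by exact_mod_cast nI_le hd I hI _
    have h00 : (0:ℝ) ≤ nZ I (0 : Fin (d+1) → ℤ) := by positivity
    have hTd : (1:ℝ) ≤ T ^ d := one_le_pow₀ h1
    rw [hs] at hb
    have hdT : (d:ℝ) ≤ 2 * (d + 1) * 3 ^ (d+1) * T ^ d := by
      have : (d:ℝ) * 1 ≤ (2 * (d + 1) * 3 ^ (d+1)) * T ^ d := by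
        apply mul_le_mul _ hTd zero_le_one (by positivity)
        nlinarith
      linarith
    have hC : C1 d * T ^ d = (d + 1) * 3 ^ (d+1) * (2 * d + 5) * T ^ d + 2 * (d + 1) * 3 ^ (d+1) * T ^ d := by
      unfold C1; ring
    rw [abs_le] at hb ⊢
    constructor <;> linarith [hb.1, hb.2]
  · push Not at h1
    have : Nall I d T = 0 := by
      unfold Nall
      apply Finset.sum_eq_zero
      intro a ha
      rw [Finset.mem_filter] at ha
      exact absurd (zpoly_lt_one h1 ha.1) ha.2
    rw [this, zero_sub, abs_neg, abs_of_nonneg (by positivity)]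
    have : T ^ (d+1) ≤ T ^ d := pow_le_pow_of_le_one hT.le h1.le (Nat.le_succ d)
    refine mul_le_mul (hV1.trans ?_) this (by positivity) (by unfold C1; positivity)
    unfold C1
    nlinarith [mul_nonneg hd0 hd3]

theorem Nprim_bound (d : ℕ) (hd : 2 ≤ d) (I : Set ℝ) (hI : I.OrdConnected) (T : ℝ) (hT : 0 < T) :
    |Nprim I d T - Vol I d / zetaR (d+1) * T ^ (d+1)| ≤ 4 * C1 d * T ^ d := by
  obtain ⟨hV0, hV1⟩ := Vol_bounds d (by omega) I hI
  have hd0 : (0:ℝ) ≤ d := by positivity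
  have hd3 : (0:ℝ) ≤ d * 3 ^ (d+1) := by positivity
  obtain ⟨m, hm⟩ := pow_unbounded_of_one_lt T (by norm_num : (1:ℝ) < 2)
  refine contraction d hd (Nall I d) (Nprim I d) (Vol I d) (C1 d) hV0 ?_
    (fun T hT => Nall_bound d (by omega) I hI T hT) (fun T hT N hN => Nall_eq I d T hT N hN) ?_ m T hT hm
  · refine hV1.trans ?_
    unfold C1
    nlinarith [mul_nonneg hd0 hd3, (by positivity : (0:ℝ) < 3 ^ (d+1))]
  · intro T hT h1
    unfold Nprim
    apply Finset.sum_eq_zero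
    intro a ha
    rw [Finset.mem_filter] at ha
    have h0 := zpoly_lt_one h1 ha.1
    have h2 := ha.2
    rw [h0] at h2
    have : Finset.univ.gcd (0 : Fin (d+1) → ℤ) = 0 := Finset.gcd_eq_zero_iff.2 (by simp)
    omega

end KL

namespace KL

open Polynomial in
def zp {d : ℕ} (a : Fin (d+1) → ℤ) : ℤ[X] := ∑ i, C (a i) * X ^ (i:ℕ)

theorem zp_coeff {d : ℕ} (a : Fin (d+1) → ℤ) (k : ℕ) :
    (zp a).coeff k = if h : k < d+1 then a ⟨k, h⟩ else 0 := by
  unfold zp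
  rw [Polynomial.finsetSum_coeff]
  simp only [Polynomial.coeff_C_mul_X_pow]
  split_ifs with h
  · rw [Finset.sum_eq_single ⟨k, h⟩]
    · simp
    · intro b _ hb
      rw [if_neg]
      rintro rfl
      exact hb rfl
    · simp
  · apply Finset.sum_eq_zero
    intro b _
    rw [if_neg]
    have := b.2
    omega

theorem zp_coeff_fin {d : ℕ} (a : Fin (d+1) → ℤ) (k : Fin (d+1)) : (zp a).coeff k = a k := by
  rw [zp_coeff, dif_pos k.2]

theorem zp_of {n : ℕ} (Q : Polynomial ℤ) (h : Q.natDegree ≤ n) :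
    zp (fun j : Fin (n+1) => Q.coeff j) = Q := by
  ext k
  rw [zp_coeff]
  split_ifs with hk
  · rfl
  · exact (Polynomial.coeff_eq_zero_of_natDegree_lt (by omega)).symm

theorem zp_natDegree_le {d : ℕ} (a : Fin (d+1) → ℤ) : (zp a).natDegree ≤ d := by
  rw [Polynomial.natDegree_le_iff_coeff_eq_zero]
  intro k hk
  rw [zp_coeff, dif_neg (by omega)]

theorem zp_primitive {d : ℕ} (a : Fin (d+1) → ℤ) (h : Finset.univ.gcd a = 1) : (zp a).IsPrimitive := by
  intro r hr
  rw [Polynomial.C_dvd_iff_dvd_coeff] at hr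
  apply isUnit_of_dvd_one
  rw [← h]
  apply Finset.dvd_gcd
  intro i _
  rw [← zp_coeff_fin a i]
  exact hr i

theorem int_isometry : Isometry (Int.castRingHom ℂ) := by
  apply AddMonoidHomClass.isometry_of_norm
  intro x
  simp [Int.norm_eq_abs]

theorem coeff_mul_bound {d : ℕ} (a : Fin (d+1) → ℤ) (H : ℕ) (ha : ∀ i, |(a i:ℝ)| ≤ H) (Q R : Polynomial ℤ)
    (hQR : zp a = Q * R) (hdeg : Q.natDegree + R.natDegree = d) (k l : ℕ) :
    (Q.coeff k).natAbs * (R.coeff l).natAbs ≤ 2 ^ d * (d+1) * H := by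
  have h1 := Polynomial.norm_coeff_le_choose_mul_mapMahlerMeasure _ int_isometry k Q
  have h2 := Polynomial.norm_coeff_le_choose_mul_mapMahlerMeasure _ int_isometry l R
  have h3 := Polynomial.mapMahlerMeasure_le_sum_norm_coeff (zp a) (Int.castRingHom ℂ) int_isometry
  rw [hQR, Polynomial.mapMahlerMeasure_mul] at h3
  rw [← hQR] at h3
  have h4 : (zp a).sum (fun _ c => ‖c‖) ≤ (d+1) * H := by
    rw [Polynomial.sum_over_range' _ (by simp) (d+1) (by have := zp_natDegree_le a; omega)]
    refine (Finset.sum_le_card_nsmul _ _ (H:ℝ) ?_).trans ?_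
    · intro i hi
      rw [Finset.mem_range] at hi
      rw [zp_coeff, dif_pos hi, Int.norm_eq_abs]
      exact ha _
    · simp
  have n1 := Polynomial.mapMahlerMeasure_nonneg Q (Int.castRingHom ℂ)
  have n2 := Polynomial.mapMahlerMeasure_nonneg R (Int.castRingHom ℂ)
  have c1 : ((Q.natDegree.choose k : ℕ):ℝ) ≤ 2 ^ Q.natDegree := by exact_mod_cast Nat.choose_le_two_pow _ _
  have c2 : ((R.natDegree.choose l : ℕ):ℝ) ≤ 2 ^ R.natDegree := by exact_mod_cast Nat.choose_le_two_pow _ _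
  have h1' := h1.trans (mul_le_mul_of_nonneg_right c1 n1)
  have h2' := h2.trans (mul_le_mul_of_nonneg_right c2 n2)
  have h5 := mul_le_mul h1' h2' (norm_nonneg _) (by positivity)
  have h6 : ‖Q.coeff k‖ * ‖R.coeff l‖ ≤ 2 ^ d * ((d+1) * H) := by
    refine h5.trans ?_
    rw [← hdeg, pow_add]
    have := mul_le_mul_of_nonneg_left (h3.trans h4) (by positivity : (0:ℝ) ≤ 2 ^ Q.natDegree * 2 ^ R.natDegree)
    rw [← hdeg] at this
    push_cast at this ⊢
    linarith
  have e : ∀ z : ℤ, ‖z‖ = (z.natAbs : ℝ) := by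
    intro z; rw [Int.norm_eq_abs, Nat.cast_natAbs]; push_cast; rfl
  rw [e, e] at h6
  have : (((Q.coeff k).natAbs * (R.coeff l).natAbs : ℕ):ℝ) ≤ ((2 ^ d * (d+1) * H : ℕ):ℝ) := by
    push_cast; linarith
  exact_mod_cast this

theorem card_zbox_le (T : ℝ) (hT : 1 ≤ T) : ((zbox T).card : ℝ) ≤ 3 * T := by
  have hsub : zbox T ⊆ Finset.Icc (-(⌊T⌋₊:ℤ)) ⌊T⌋₊ := by
    intro x hx
    rw [mem_zbox] at hx
    rw [Finset.mem_Icc]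
    have : x.natAbs ≤ ⌊T⌋₊ := by
      apply Nat.le_floor
      rw [Nat.cast_natAbs]; push_cast; exact hx
    constructor <;> omega
  have h := Finset.card_le_card hsub
  rw [Int.card_Icc] at h
  have h' : (zbox T).card ≤ 2 * ⌊T⌋₊ + 1 := by omega
  have h2 : ((zbox T).card:ℝ) ≤ 2 * ⌊T⌋₊ + 1 := by exact_mod_cast h'
  have := Nat.floor_le (by linarith : 0 ≤ T)
  linarith

theorem card_zpoly_le (T : ℝ) (hT : 1 ≤ T) (n : ℕ) : ((zpoly T n).card : ℝ) ≤ (3 * T) ^ (n+1) := by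
  unfold zpoly
  rw [Fintype.card_piFinset]
  simp only [Finset.prod_const, Finset.card_univ, Fintype.card_fin]
  push_cast
  exact pow_le_pow_left₀ (by positivity) (card_zbox_le T hT) _

end KL

namespace KL

def Pr (d B i m : ℕ) : Finset (Fin (d+1) → ℤ) :=
  ((zpoly ((2:ℝ)^(m+1)) i) ×ˢ (zpoly ((B:ℝ)/2^m) (d-i))).image
    (fun p => fun k : Fin (d+1) => (zp p.1 * zp p.2).coeff k)

theorem factor_exists {d : ℕ} (hd : 2 ≤ d) (a : Fin (d+1) → ℤ) (hg : Finset.univ.gcd a = 1)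
    (hdeg : (zp a).natDegree = d) (hr : ¬ Irreducible (zp a)) :
    ∃ Q R : Polynomial ℤ, zp a = Q * R ∧ Q.natDegree + R.natDegree = d ∧ 1 ≤ Q.natDegree ∧
      2 * Q.natDegree ≤ d := by
  have hp := zp_primitive a hg
  have hne : zp a ≠ 0 := by
    intro h; rw [h] at hdeg; simp at hdeg; omega
  have hnu : ¬ IsUnit (zp a) := by
    intro h
    have := Polynomial.natDegree_eq_zero_of_isUnit h
    omega
  have : ∃ Q R : Polynomial ℤ, zp a = Q * R ∧ ¬ IsUnit Q ∧ ¬ IsUnit R := by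
    by_contra hcon
    push Not at hcon
    apply hr
    refine ⟨hnu, fun {Q R} h => ?_⟩
    by_cases hQ : IsUnit Q
    · exact Or.inl hQ
    · exact Or.inr (hcon Q R h hQ)
  obtain ⟨Q, R, hQR, hQ, hR⟩ := this
  have hQ0 : Q ≠ 0 := by rintro rfl; simp at hQR; exact hne hQR
  have hR0 : R ≠ 0 := by rintro rfl; simp at hQR; exact hne hQR
  have hsum : Q.natDegree + R.natDegree = d := by
    rw [← Polynomial.natDegree_mul hQ0 hR0, ← hQR, hdeg]
  have key : ∀ S : Polynomial ℤ, S ∣ zp a → ¬ IsUnit S → 1 ≤ S.natDegree := by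
    intro S hS hSu
    by_contra h
    have h0 : S.natDegree = 0 := by omega
    rw [Polynomial.eq_C_of_natDegree_eq_zero h0] at hS hSu
    exact hSu ((hp _ hS).map Polynomial.C)
  have k1 := key Q ⟨R, hQR⟩ hQ
  have k2 := key R ⟨Q, by rw [hQR, mul_comm]⟩ hR
  by_cases hle : Q.natDegree ≤ R.natDegree
  · exact ⟨Q, R, hQR, hsum, k1, by omega⟩
  · exact ⟨R, Q, by rw [hQR, mul_comm], by omega, k2, by omega⟩

def ht (Q : Polynomial ℤ) : ℕ := (Finset.range (Q.natDegree+1)).sup fun k => (Q.coeff k).natAbs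

theorem le_ht (Q : Polynomial ℤ) (k : ℕ) : (Q.coeff k).natAbs ≤ ht Q := by
  by_cases hk : k < Q.natDegree + 1
  · exact Finset.le_sup (f := fun k => (Q.coeff k).natAbs) (Finset.mem_range.2 hk)
  · rw [Polynomial.coeff_eq_zero_of_natDegree_lt (by omega)]; simp

theorem ht_attained (Q : Polynomial ℤ) : ∃ k, ht Q = (Q.coeff k).natAbs := by
  obtain ⟨k, _, hk⟩ := Finset.exists_mem_eq_sup (Finset.range (Q.natDegree+1)) ⟨0, by simp⟩
    (fun k => (Q.coeff k).natAbs)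
  exact ⟨k, hk⟩

theorem ht_pos (Q : Polynomial ℤ) (h : Q ≠ 0) : 1 ≤ ht Q := by
  have := le_ht Q Q.natDegree
  have h2 : (Q.coeff Q.natDegree).natAbs ≠ 0 := by
    rw [Int.natAbs_ne_zero]; exact Polynomial.leadingCoeff_ne_zero.2 h
  omega

theorem mem_Pr {d : ℕ} (hd : 2 ≤ d) (H : ℕ) (a : Fin (d+1) → ℤ) (ha : ∀ i, |(a i:ℝ)| ≤ H)
    (hg : Finset.univ.gcd a = 1) (hdeg : (zp a).natDegree = d) (hr : ¬ Irreducible (zp a)) :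
    ∃ i ∈ Finset.Icc 1 (d/2), ∃ m ∈ Finset.range (Nat.log 2 (2 ^ d * (d+1) * H) + 1),
      a ∈ Pr d (2 ^ d * (d+1) * H) i m := by
  set B := 2 ^ d * (d+1) * H with hB
  obtain ⟨Q, R, hQR, hsum, h1, h2⟩ := factor_exists hd a hg hdeg hr
  have hb : ht Q * ht R ≤ B := by
    obtain ⟨k, hk⟩ := ht_attained Q
    obtain ⟨l, hl⟩ := ht_attained R
    rw [hk, hl]
    exact coeff_mul_bound a H ha Q R hQR hsum k l
  have hne : zp a ≠ 0 := by
    intro h; rw [h] at hdeg; simp at hdeg; omega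
  have hQ0 : Q ≠ 0 := by rintro rfl; simp at hQR; exact hne hQR
  have hR0 : R ≠ 0 := by rintro rfl; simp at hQR; exact hne hQR
  have p1 := ht_pos Q hQ0
  have p2 := ht_pos R hR0
  have hm1 : 2 ^ Nat.log 2 (ht Q) ≤ ht Q := Nat.pow_log_le_self 2 (by omega)
  have hm2 : ht Q < 2 ^ (Nat.log 2 (ht Q) + 1) := Nat.lt_pow_succ_log_self (by norm_num) _
  refine ⟨Q.natDegree, by rw [Finset.mem_Icc]; omega, Nat.log 2 (ht Q), ?_, ?_⟩
  · rw [Finset.mem_range]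
    have : Nat.log 2 (ht Q) ≤ Nat.log 2 B := Nat.log_mono_right (by nlinarith)
    omega
  · unfold Pr
    rw [Finset.mem_image]
    refine ⟨(fun j => Q.coeff j, fun j => R.coeff j), ?_, ?_⟩
    · rw [Finset.mem_product]
      simp only [mem_zpoly]
      have e : ∀ z : ℤ, |(z:ℝ)| = (z.natAbs : ℝ) := by
        intro z; rw [Nat.cast_natAbs]; push_cast; rfl
      constructor
      · intro i
        rw [e]
        exact_mod_cast (le_ht Q i).trans hm2.le
      · intro i
        rw [e, le_div_iff₀ (by positivity)]
        have := le_ht R i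
        have h3 : (R.coeff i).natAbs * 2 ^ Nat.log 2 (ht Q) ≤ B := by
          refine (Nat.mul_le_mul this hm1).trans ?_
          rw [mul_comm]; exact hb
        exact_mod_cast h3
    · simp only
      rw [zp_of Q le_rfl, zp_of R (by omega), ← hQR]
      ext k
      exact zp_coeff_fin a k

theorem card_Pr0 (d B i m : ℕ) :
    (Pr d B i m).card ≤ (zpoly ((2:ℝ)^(m+1)) i).card * (zpoly ((B:ℝ)/2^m) (d-i)).card := by
  rw [← Finset.card_product]
  exact Finset.card_image_le

theorem card_Pr {d : ℕ} (B i m : ℕ) (hi : 1 ≤ i) (hid : 2 * i ≤ d) (hm : 2 ^ m ≤ B) :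
    ((Pr d B i m).card : ℝ) ≤ 6 ^ (d+2) * (if d = 2 then (B:ℝ) ^ d else B ^ d * (1/2)^m) := by
  have hBm : (2:ℝ)^m ≤ B := by exact_mod_cast hm
  have h2m : (1:ℝ) ≤ 2 ^ m := one_le_pow₀ (by norm_num)
  have hB1 : (1:ℝ) ≤ B := h2m.trans hBm
  have hc : ((Pr d B i m).card : ℝ) ≤ (3 * (2:ℝ)^(m+1)) ^ (i+1) * (3 * ((B:ℝ)/2^m)) ^ (d-i+1) := by
    have h' : ((Pr d B i m).card : ℝ) ≤ (zpoly ((2:ℝ)^(m+1)) i).card * (zpoly ((B:ℝ)/2^m) (d-i)).card := by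
      rw [← Nat.cast_mul]
      exact Nat.cast_le.2 (card_Pr0 d B i m)
    refine h'.trans (mul_le_mul (card_zpoly_le _ (one_le_pow₀ (by norm_num)) _) (card_zpoly_le _ ?_ _) (by positivity)
      (by positivity))
    rw [le_div_iff₀ (by positivity)]; linarith
  refine hc.trans ?_
  have e : (3 * (2:ℝ)^(m+1)) ^ (i+1) * (3 * ((B:ℝ)/2^m)) ^ (d-i+1)
      = 6 ^ (i+1) * 3 ^ (d-i+1) * (B ^ (d-i+1) * (1/2^m) ^ (d - 2 * i)) := by
    obtain ⟨j, rfl⟩ : ∃ j, d = 2 * i + j := ⟨d - 2 * i, by omega⟩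
    rw [show 2 * i + j - i + 1 = (i + 1) + j by omega, show 2 * i + j - 2 * i = j by omega]
    have : (3 * (2:ℝ)^(m+1)) = 6 * 2 ^ m := by ring
    rw [this, mul_pow, mul_pow, div_pow, pow_add ((2:ℝ)^m) (i+1) j, one_div, inv_pow]
    field_simp
  rw [e]
  refine mul_le_mul ?_ ?_ (by positivity) (by positivity)
  · calc (6:ℝ) ^ (i+1) * 3 ^ (d-i+1) ≤ 6 ^ (i+1) * 6 ^ (d-i+1) := by gcongr; norm_num
      _ = 6 ^ (d+2) := by rw [← pow_add]; congr 1; omega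
  · split_ifs with h2
    · subst h2
      obtain rfl : i = 1 := by omega
      simp
    · have hinv : (1:ℝ)/2^m ≤ 1 := by rw [div_le_one (by positivity)]; exact h2m
      have hinv0 : (0:ℝ) ≤ 1/2^m := by positivity
      rw [one_div_pow (2:ℝ) m]
      by_cases h1 : i = 1
      · subst h1
        rw [show d - 1 + 1 = d by omega]
        refine mul_le_mul_of_nonneg_left ?_ (by positivity)
        calc ((1:ℝ)/2^m) ^ (d - 2 * 1) ≤ (1/2^m) ^ 1 := pow_le_pow_of_le_one hinv0 hinv (by omega)
          _ = _ := by rw [pow_one]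
      · calc (B:ℝ) ^ (d-i+1) * (1/2^m) ^ (d - 2 * i) ≤ B ^ (d-1) * 1 :=
              mul_le_mul (pow_le_pow_right₀ hB1 (by omega)) (pow_le_one₀ hinv0 hinv) (by positivity) (by positivity)
          _ ≤ B ^ (d-1) * (B * (1/2^m)) := by
              refine mul_le_mul_of_nonneg_left ?_ (by positivity)
              rw [mul_one_div, le_div_iff₀ (by positivity)]; linarith
          _ = B ^ d * (1/2^m) := by
              rw [← mul_assoc, ← pow_succ, show d - 1 + 1 = d by omega]

def Bad (d H : ℕ) : Finset (Fin (d+1) → ℤ) := by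
  classical
  exact (zpoly (H:ℝ) d).filter
    (fun a => Finset.univ.gcd a = 1 ∧ ¬ (Irreducible (zp a) ∧ (zp a).natDegree = d))

theorem mem_Bad {d H : ℕ} {a : Fin (d+1) → ℤ} : a ∈ Bad d H ↔ (∀ i, |(a i:ℝ)| ≤ H) ∧
    Finset.univ.gcd a = 1 ∧ ¬ (Irreducible (zp a) ∧ (zp a).natDegree = d) := by
  simp [Bad, mem_zpoly]

def Low (d H : ℕ) : Finset (Fin (d+1) → ℤ) :=
  Fintype.piFinset fun i => if i = Fin.last d then {0} else zbox (H:ℝ)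

theorem card_Low (d H : ℕ) (hH : 1 ≤ H) : ((Low d H).card : ℝ) ≤ (3 * H) ^ d := by
  unfold Low
  rw [Fintype.card_piFinset, Fin.prod_univ_castSucc]
  have : ∀ i : Fin d, Fin.castSucc i ≠ Fin.last d := fun i => (Fin.castSucc_lt_last i).ne
  simp only [this, if_false, if_true, Finset.card_singleton, mul_one, Finset.prod_const, Finset.card_univ, Fintype.card_fin]
  push_cast
  exact pow_le_pow_left₀ (by positivity) (card_zbox_le _ (by exact_mod_cast hH)) _

theorem Bad_sub (d H : ℕ) (hd : 2 ≤ d) : Bad d H ⊆ Low d H ∪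
    (Finset.Icc 1 (d/2)).biUnion (fun i => (Finset.range (Nat.log 2 (2 ^ d * (d+1) * H) + 1)).biUnion
      (fun m => Pr d (2 ^ d * (d+1) * H) i m)) := by
  intro a ha
  rw [mem_Bad] at ha
  obtain ⟨h1, h2, h3⟩ := ha
  rw [Finset.mem_union]
  by_cases h0 : a (Fin.last d) = 0
  · left
    rw [Low, Fintype.mem_piFinset]
    intro i
    split_ifs with hi
    · rw [hi, h0]; simp
    · exact mem_zbox.2 (h1 i)
  · right
    have hdeg : (zp a).natDegree = d := by
      apply le_antisymm (zp_natDegree_le a)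
      apply Polynomial.le_natDegree_of_ne_zero
      have := zp_coeff_fin a (Fin.last d)
      rw [Fin.val_last] at this
      rw [this]; exact h0
    have hr : ¬ Irreducible (zp a) := fun h => h3 ⟨h, hdeg⟩
    obtain ⟨i, hi, m, hm, hmem⟩ := mem_Pr hd H a h1 h2 hdeg hr
    simp only [Finset.mem_biUnion]
    exact ⟨i, hi, m, hm, hmem⟩

theorem card_Bad (d H : ℕ) (hd : 2 ≤ d) (hH : 2 ≤ H) : ((Bad d H).card : ℝ) ≤
    (3 * H) ^ d + d * (6 ^ (d+2) * ((2 ^ d * (d+1) * H) ^ d * (if d = 2 then 12 * Real.log H else 2))) := by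
  set B := 2 ^ d * (d+1) * H with hB
  have hBpos : 0 < B := by positivity
  have hc := Finset.card_le_card (Bad_sub d H hd)
  rw [← hB] at hc
  have hc2 := hc.trans (Finset.card_union_le _ _)
  have hc3 : ((Bad d H).card : ℝ) ≤ (Low d H).card + ∑ i ∈ Finset.Icc 1 (d/2),
      ∑ m ∈ Finset.range (Nat.log 2 B + 1), ((Pr d B i m).card : ℝ) := by
    have : (Bad d H).card ≤ (Low d H).card + ∑ i ∈ Finset.Icc 1 (d/2),
      ∑ m ∈ Finset.range (Nat.log 2 B + 1), (Pr d B i m).card := by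
      refine hc2.trans (Nat.add_le_add_left ?_ _)
      refine Finset.card_biUnion_le.trans (Finset.sum_le_sum fun i _ => Finset.card_biUnion_le)
    exact_mod_cast this
  refine hc3.trans (add_le_add (card_Low d H (by omega)) ?_)
  have hinner : ∀ i ∈ Finset.Icc 1 (d/2), ∑ m ∈ Finset.range (Nat.log 2 B + 1), ((Pr d B i m).card : ℝ)
      ≤ 6 ^ (d+2) * ((B:ℝ) ^ d * (if d = 2 then 12 * Real.log H else 2)) := by
    intro i hi
    rw [Finset.mem_Icc] at hi
    have h1 : ∀ m ∈ Finset.range (Nat.log 2 B + 1), ((Pr d B i m).card : ℝ) ≤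
        6 ^ (d+2) * (if d = 2 then (B:ℝ) ^ d else B ^ d * (1/2)^m) := by
      intro m hm
      rw [Finset.mem_range] at hm
      exact card_Pr B i m hi.1 (by omega) (Nat.pow_le_of_le_log hBpos.ne' (by omega))
    refine (Finset.sum_le_sum h1).trans ?_
    rw [← Finset.mul_sum]
    refine mul_le_mul_of_nonneg_left ?_ (by positivity)
    split_ifs with h2
    · rw [Finset.sum_const, Finset.card_range, nsmul_eq_mul, mul_comm]
      refine mul_le_mul_of_nonneg_left ?_ (by positivity)
      have hl : (Nat.log 2 B : ℝ) ≤ Real.logb 2 B := by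
        exact_mod_cast Real.natLog_le_logb B 2
      have hBle : (B:ℝ) ≤ H ^ 5 := by
        rw [hB, h2]; push_cast
        have hH2 : (2:ℝ) ≤ H := by exact_mod_cast hH
        have : (2:ℝ)^4 ≤ (H:ℝ)^4 := pow_le_pow_left₀ (by norm_num) hH2 4
        nlinarith
      have hlogB : Real.log B ≤ 5 * Real.log H := by
        have := Real.log_le_log (by exact_mod_cast hBpos) hBle
        rw [Real.log_pow] at this
        exact_mod_cast this
      have hlog2 : (1/2:ℝ) ≤ Real.log 2 := by linarith [Real.log_two_gt_d9]
      have hlogH : Real.log 2 ≤ Real.log H := Real.log_le_log (by norm_num) (by exact_mod_cast hH)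
      have : Real.logb 2 B ≤ 10 * Real.log H := by
        rw [Real.logb, div_le_iff₀ (by linarith)]
        nlinarith
      push_cast
      linarith
    · rw [← Finset.mul_sum]
      refine mul_le_mul_of_nonneg_left ?_ (by positivity)
      have := Summable.sum_le_tsum (Finset.range (Nat.log 2 B + 1)) (fun m _ => by positivity)
        (summable_geometric_two)
      rwa [tsum_geometric_two] at this
  refine (Finset.sum_le_card_nsmul _ _ _ hinner).trans ?_
  rw [nsmul_eq_mul, Nat.card_Icc]
  have hB' : (B:ℝ) = 2 ^ d * (d+1) * H := by rw [hB]; push_cast; ring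
  rw [hB']
  refine mul_le_mul_of_nonneg_right ?_ ?_
  · have : d / 2 + 1 - 1 ≤ d := by omega
    exact_mod_cast this
  · have : 0 ≤ Real.log H := Real.log_natCast_nonneg H
    split_ifs <;> positivity

end KL

namespace KL

theorem irr_eq_or_neg (P Q : Polynomial ℤ) (hP : Irreducible P) (hQ : Irreducible Q)
    (dP : P.natDegree ≠ 0) (dQ : Q.natDegree ≠ 0) (x : ℝ)
    (rP : Polynomial.aeval x P = 0) (rQ : Polynomial.aeval x Q = 0) : Q = P ∨ Q = -P := by
  have pP := hP.isPrimitive dP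
  have pQ := hQ.isPrimitive dQ
  have iP := (Polynomial.IsPrimitive.Int.irreducible_iff_irreducible_map_cast pP).1 hP
  have iQ := (Polynomial.IsPrimitive.Int.irreducible_iff_irreducible_map_cast pQ).1 hQ
  have rP' : Polynomial.aeval x (P.map (Int.castRingHom ℚ)) = 0 := by
    have := Polynomial.aeval_map_algebraMap ℚ x P
    rw [rP] at this; exact this
  have rQ' : Polynomial.aeval x (Q.map (Int.castRingHom ℚ)) = 0 := by
    have := Polynomial.aeval_map_algebraMap ℚ x Q
    rw [rQ] at this; exact this
  have m1 := minpoly.dvd ℚ x rP'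
  have m2 := minpoly.dvd ℚ x rQ'
  have hintg : IsIntegral ℚ x := IsAlgebraic.isIntegral ⟨_, iP.ne_zero, rP'⟩
  have m3 := (minpoly.irreducible hintg).dvd_symm iP m1
  have m4 := m3.trans m2
  have m5 := (Polynomial.IsPrimitive.Int.dvd_iff_map_cast_dvd_map_cast P Q pP).2 m4
  obtain ⟨u, hu⟩ := hP.associated_of_dvd hQ m5
  obtain ⟨r, hr, hru⟩ := Polynomial.isUnit_iff.1 u.isUnit
  rw [← hu, ← hru]
  rcases Int.isUnit_iff.1 hr with h | h
  · left; rw [h]; simp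
  · right; rw [h]; simp

theorem aeval_zp {d : ℕ} (a : Fin (d+1) → ℤ) (x : ℝ) :
    Polynomial.aeval x (zp a) = ev (fun i => (a i : ℝ)) x := by
  simp [zp, ev, map_sum]

theorem zp_neg {d : ℕ} (a : Fin (d+1) → ℤ) : zp (-a) = - zp a := by
  simp [zp, Finset.sum_neg_distrib]

theorem zp_inj {d : ℕ} {a b : Fin (d+1) → ℤ} (h : zp a = zp b) : a = b := by
  ext i
  rw [← zp_coeff_fin a i, h, zp_coeff_fin]

def Good (d H : ℕ) : Finset (Fin (d+1) → ℤ) := by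
  classical
  exact (zpoly (H:ℝ) d).filter (fun a => Irreducible (zp a) ∧ (zp a).natDegree = d)

theorem mem_Good {d H : ℕ} {a : Fin (d+1) → ℤ} : a ∈ Good d H ↔ (∀ i, |(a i:ℝ)| ≤ H) ∧
    (Irreducible (zp a) ∧ (zp a).natDegree = d) := by
  simp [Good, mem_zpoly]

theorem gcd_of_primitive {d : ℕ} (a : Fin (d+1) → ℤ) (h : (zp a).IsPrimitive) : Finset.univ.gcd a = 1 := by
  have hu : IsUnit (Finset.univ.gcd a) := by
    apply h
    rw [Polynomial.C_dvd_iff_dvd_coeff]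
    intro k
    rw [zp_coeff]
    split_ifs with hk
    · exact Finset.gcd_dvd (Finset.mem_univ _)
    · simp
  have := Finset.normalize_gcd (s := Finset.univ) (f := a)
  rw [← this]
  exact normalize_eq_one.2 hu

theorem Nprim_split (I : Set ℝ) (d H : ℕ) (hd : 2 ≤ d) :
    Nprim I d H = ∑ a ∈ Good d H, (nZ I a : ℝ) + ∑ a ∈ Bad d H, (nZ I a : ℝ) := by
  classical
  rw [← Finset.sum_union]
  · unfold Nprim
    refine Finset.sum_congr ?_ fun _ _ => rfl
    ext a
    rw [Finset.mem_union, mem_Good, mem_Bad, Finset.mem_filter, mem_zpoly]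
    constructor
    · rintro ⟨h1, h2⟩
      by_cases h : Irreducible (zp a) ∧ (zp a).natDegree = d
      · exact Or.inl ⟨h1, h⟩
      · exact Or.inr ⟨h1, h2, h⟩
    · rintro (⟨h1, h2, h3⟩ | ⟨h1, h2, -⟩)
      · exact ⟨h1, gcd_of_primitive a (h2.isPrimitive (by omega))⟩
      · exact ⟨h1, h2⟩
  · rw [Finset.disjoint_left]
    intro a h1 h2
    exact (mem_Bad.1 h2).2.2 (mem_Good.1 h1).2

theorem alg_iff (d H : ℕ) (x : ℝ) : x ∈ algSet d H ↔ ∃ a ∈ Good d H, ev (fun i => (a i : ℝ)) x = 0 := by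
  constructor
  · rintro ⟨P, h1, h2, h3, h4⟩
    have e := zp_of (n := d) P h2.le
    refine ⟨fun j => P.coeff j, ?_, ?_⟩
    · rw [mem_Good, e]
      exact ⟨fun i => h3 i, h1, h2⟩
    · rw [← aeval_zp, e]; exact h4
  · rintro ⟨a, ha, hx⟩
    rw [mem_Good] at ha
    refine ⟨zp a, ha.2.1, ha.2.2, fun k => ?_, by rw [aeval_zp]; exact hx⟩
    rw [zp_coeff]
    split_ifs with hk
    · exact ha.1 _
    · simp

theorem Good_ne {d H : ℕ} {a : Fin (d+1) → ℤ} (ha : a ∈ Good d H) : a ≠ 0 := by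
  rintro rfl
  have := (mem_Good.1 ha).2.1.ne_zero
  apply this
  simp [zp]

theorem Good_count (I : Set ℝ) (d H : ℕ) (hd : 2 ≤ d) :
    ∑ a ∈ Good d H, nZ I a = 2 * (algSet d H ∩ I).ncard := by
  classical
  have hfa : ∀ a ∈ Good d H, ({x | x ∈ I ∧ ev (fun i => (a i : ℝ)) x = 0} : Set ℝ).Finite := by
    intro a ha
    apply rts_finite
    intro h
    apply Good_ne ha
    ext i
    have := congrFun h i
    simpa using this
  have hS : (algSet d H ∩ I) = ⋃ a ∈ Good d H, {x | x ∈ I ∧ ev (fun i => (a i : ℝ)) x = 0} := by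
    ext x
    simp only [mem_inter_iff, alg_iff, mem_iUnion, mem_ofPred_eq]
    constructor
    · rintro ⟨⟨a, h1, h2⟩, h3⟩; exact ⟨a, h1, h3, h2⟩
    · rintro ⟨a, h1, h3, h2⟩; exact ⟨⟨a, h1, h2⟩, h3⟩
  have hfin : (algSet d H ∩ I).Finite := by
    rw [hS]
    exact (Good d H).finite_toSet.biUnion hfa
  set t := hfin.toFinset with ht
  have hn : ∀ a ∈ Good d H, nZ I a = (t.bipartiteAbove (fun a x => ev (fun i => ((a : Fin (d+1) → ℤ) i : ℝ)) x = 0) a).card := by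
    intro a ha
    unfold nZ nI
    rw [← Set.ncard_coe_finset]
    congr 1
    ext x
    simp only [Finset.coe_bipartiteAbove, mem_ofPred_eq, ht, Finite.mem_toFinset, mem_inter_iff, alg_iff]
    constructor
    · rintro ⟨h1, h2⟩; exact ⟨⟨⟨a, ha, h2⟩, h1⟩, h2⟩
    · rintro ⟨⟨_, h1⟩, h2⟩; exact ⟨h1, h2⟩
  rw [Finset.sum_congr rfl hn, Finset.sum_card_bipartiteAbove_eq_sum_card_bipartiteBelow]
  have h2 : ∀ x ∈ t, ((Good d H).bipartiteBelow (fun a x => ev (fun i => ((a : Fin (d+1) → ℤ) i : ℝ)) x = 0) x).card = 2 := by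
    intro x hx
    rw [ht, Finite.mem_toFinset] at hx
    obtain ⟨a, ha, hax⟩ := (alg_iff d H x).1 hx.1
    have hne : a ≠ -a := by
      intro h
      apply Good_ne ha
      ext i
      have := congrFun h i
      simp only [Pi.neg_apply] at this
      simp only [Pi.zero_apply]
      omega
    rw [← Finset.card_pair hne]
    congr 1
    have hG := mem_Good.1 ha
    ext b
    rw [Finset.mem_bipartiteBelow, Finset.mem_insert, Finset.mem_singleton]
    constructor
    · rintro ⟨hb, hbx⟩
      have hGb := mem_Good.1 hb
      rw [← aeval_zp] at hax hbx
      rcases irr_eq_or_neg (zp a) (zp b) hG.2.1 hGb.2.1 (by omega) (by omega) x hax hbx with h | h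
      · left; exact zp_inj h
      · right; apply zp_inj; rw [h, zp_neg]
    · rintro (rfl | rfl)
      · exact ⟨ha, hax⟩
      · refine ⟨?_, ?_⟩
        · rw [mem_Good, zp_neg]
          refine ⟨fun i => ?_, ?_, ?_⟩
          · simpa using hG.1 i
          · exact (Associated.irreducible_iff (Associated.neg_left (Associated.refl _))).2 hG.2.1
          · rw [Polynomial.natDegree_neg]; exact hG.2.2
        · rw [← aeval_zp] at hax ⊢
          rw [zp_neg, map_neg, hax, neg_zero]
  rw [Finset.sum_const_nat h2, mul_comm, Set.ncard_eq_toFinset_card _ hfin]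

theorem count_diff (I : Set ℝ) (hI : I.OrdConnected) (d H : ℕ) (hd : 2 ≤ d) :
    |2 * ((algSet d H ∩ I).ncard : ℝ) - Nprim I d H| ≤ d * (Bad d H).card := by
  rw [Nprim_split I d H hd]
  have h := Good_count I d H hd
  have h' : ∑ a ∈ Good d H, (nZ I a : ℝ) = 2 * ((algSet d H ∩ I).ncard : ℝ) := by exact_mod_cast h
  rw [h', sub_add_cancel_left, abs_neg, abs_of_nonneg (Finset.sum_nonneg fun _ _ => by positivity)]
  have := Finset.sum_le_card_nsmul (Bad d H) (fun a => (nZ I a : ℝ)) d (by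
    intro a _
    have := nI_le (by omega : 1 ≤ d) I hI (fun i => (a i:ℝ))
    exact_mod_cast this)
  rw [nsmul_eq_mul] at this
  linarith

end KL

namespace KL

theorem pK_ge (d : ℕ) (hd : 2 ≤ d) : 4 ^ (d+1) ≤ pK d := by
  unfold pK
  have h1 : 3 * (d+1) + 1 ≤ 4 ^ (d+1) := by
    clear hd
    induction d with
    | zero => norm_num
    | succ d ih => rw [pow_succ]; omega
  have h2 : d + 1 ≤ (4 ^ (d+1) - 1) / 3 := by omega
  calc 4 ^ (d+1) ≤ 4 ^ ((4 ^ (d+1) - 1) / 3) := Nat.pow_le_pow_right (by norm_num) h2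
    _ = 4 ^ ((4 ^ (d+1) - 1) / 3) * 1 := (mul_one _).symm
    _ ≤ _ := Nat.mul_le_mul_left _ (Nat.one_le_pow _ _ (by omega))

theorem sK_ge (d : ℕ) (hd : 2 ≤ d) : 2 * d + 7 ≤ sK d := by
  unfold sK
  have h1 : 1 ≤ d ^ ((16 ^ (d + 1) - 1) * ⌈Real.log d / Real.log 2⌉₊) := Nat.one_le_pow _ _ (by omega)
  have h2 : 2 * d + 3 ≤ (2 * d + 3) ^ (2 ^ (d + 1)) := Nat.le_self_pow (by positivity) _
  calc 2 * d + 7 ≤ 3 * (2 * d + 3) * 1 := by omega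
    _ ≤ _ := Nat.mul_le_mul (Nat.mul_le_mul_left _ h2) h1

theorem K1_ge (d : ℕ) (hd : 2 ≤ d) : ((4:ℝ) ^ (d+1)) ^ (2 * d + 7) ≤ K1 d := by
  have hp : (4:ℝ) ^ (d+1) ≤ pK d := by exact_mod_cast pK_ge d hd
  have hX : (1:ℝ) ≤ 4 ^ (d+1) := one_le_pow₀ (by norm_num)
  have hp1 : (1:ℝ) ≤ pK d := hX.trans hp
  have hd1 : (1:ℝ) ≤ d := by exact_mod_cast (by omega : 1 ≤ d)
  set p : ℝ := (pK d : ℝ)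
  have h1 : ((4:ℝ) ^ (d+1)) ^ (2 * d + 7) ≤ (2 * p - 1) ^ sK d :=
    calc ((4:ℝ) ^ (d+1)) ^ (2 * d + 7) ≤ (4 ^ (d+1)) ^ sK d := pow_le_pow_right₀ hX (sK_ge d hd)
      _ ≤ _ := pow_le_pow_left₀ (by positivity) (by linarith) _
  unfold K1
  set Y := (2 * p - 1) ^ sK d
  have hY : 0 ≤ Y := le_trans (by positivity) h1
  have hA : 0 ≤ 12 * (d : ℝ) ^ 2 * 2 ^ (d * (d - 2)) * ((d : ℝ) + 1) ^ ((d : ℝ) / 2) := by positivity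
  set A := 12 * (d : ℝ) ^ 2 * 2 ^ (d * (d - 2)) * ((d : ℝ) + 1) ^ ((d : ℝ) / 2)
  have h2 : (1:ℝ) ≤ 2 ^ (d+2) * p := one_le_mul_of_one_le_of_one_le (one_le_pow₀ (by norm_num)) hp1
  have h3 : Y ≤ 2 ^ (d+2) * p * Y := le_mul_of_one_le_left hY h2
  have h4 : Y ≤ A + 2 ^ (d+2) * p * Y := by linarith
  have h5 : A + 2 ^ (d+2) * p * Y ≤ d * (A + 2 ^ (d+2) * p * Y) :=
    le_mul_of_one_le_left (by linarith) hd1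
  linarith

theorem const_le (d : ℕ) (hd : 2 ≤ d) :
    4 * C1 d + d * 3 ^ d + 6 * d ^ 2 * (6 ^ (d+2) * (2 ^ d * (d+1)) ^ d) ≤ ((4:ℝ) ^ (d+1)) ^ (2 * d + 7) := by
  have hd1 : (1:ℝ) ≤ d := by exact_mod_cast (by omega : 1 ≤ d)
  have hX64 : (64:ℝ) ≤ 4 ^ (d+1) := by
    calc (64:ℝ) = 4 ^ 3 := by norm_num
      _ ≤ _ := pow_le_pow_right₀ (by norm_num) (by omega)
  have hdX : 2 * (d:ℝ) + 7 ≤ 4 ^ (d+1) := by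
    have : 2 * d + 7 ≤ 4 ^ (d+1) := by
      clear hd1 hX64
      induction d, hd using Nat.le_induction with
      | base => norm_num
      | succ d _ ih => rw [pow_succ]; omega
    exact_mod_cast this
  have h3 : (3:ℝ) ^ (d+1) ≤ 4 ^ (d+1) := pow_le_pow_left₀ (by norm_num) (by norm_num) _
  have h3' : (3:ℝ) ^ d ≤ 4 ^ (d+1) := (pow_le_pow_right₀ (by norm_num) (Nat.le_succ d)).trans h3
  have h2' : (2:ℝ) ^ d ≤ 4 ^ (d+1) :=
    (pow_le_pow_right₀ (by norm_num) (Nat.le_succ d)).trans (pow_le_pow_left₀ (by norm_num) (by norm_num) _)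
  have h6 : (6:ℝ) ^ (d+2) ≤ 4 ^ (d+1) * (4 ^ (d+1)) ^ 2 := by
    rw [pow_succ, mul_comm]
    refine mul_le_mul (by linarith) ?_ (by positivity) (by positivity)
    rw [← pow_mul, mul_comm, pow_mul]
    exact pow_le_pow_left₀ (by norm_num) (by norm_num) _
  set X : ℝ := 4 ^ (d+1)
  clear_value X
  have hX0 : (0:ℝ) < X := by linarith
  have hX1 : (1:ℝ) ≤ X := by linarith
  have a1 : 4 * C1 d ≤ X ^ (2 * d + 6) := by
    calc 4 * C1 d ≤ X * (X * X * X) := by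
          unfold C1
          exact mul_le_mul (by linarith) (mul_le_mul (mul_le_mul (by linarith) h3 (by positivity) hX0.le) hdX
            (by positivity) (by positivity)) (by positivity) hX0.le
      _ = X ^ 4 := by ring
      _ ≤ _ := pow_le_pow_right₀ hX1 (by omega)
  have a2 : d * 3 ^ d ≤ X ^ (2 * d + 6) := by
    calc (d:ℝ) * 3 ^ d ≤ X * X := mul_le_mul (by linarith) h3' (by positivity) hX0.le
      _ = X ^ 2 := by ring
      _ ≤ _ := pow_le_pow_right₀ hX1 (by omega)
  have a3 : 6 * d ^ 2 * (6 ^ (d+2) * (2 ^ d * (d+1)) ^ d) ≤ X ^ (2 * d + 6) := by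
    calc 6 * (d:ℝ) ^ 2 * (6 ^ (d+2) * (2 ^ d * (d+1)) ^ d) ≤ X * X ^ 2 * (X * X ^ 2 * (X * X) ^ d) := by
          refine mul_le_mul (mul_le_mul (by linarith) (pow_le_pow_left₀ (by linarith) (by linarith) _) (by positivity) hX0.le)
            (mul_le_mul h6 (pow_le_pow_left₀ (by positivity) (mul_le_mul h2' (by linarith) (by positivity) hX0.le) _)
              (by positivity) (by positivity)) (by positivity) (by positivity)
      _ = X ^ (2 * d + 6) := by
          rw [← sq X, ← pow_mul]; ring
  have a4 : X ^ (2 * d + 7) = X * X ^ (2 * d + 6) := by ring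
  have : 0 < X ^ (2 * d + 6) := by positivity
  rw [a4]
  nlinarith

end KL

theorem stmt5 (d : ℕ) (hd : 2 ≤ d) (I : Set ℝ) (hI : I.OrdConnected)
    (H : ℕ) (hH : 2 ≤ H) :
    |(Set.ncard (algSet d H ∩ I) : ℝ) / (H : ℝ) ^ (d + 1) -
        (1 / (2 * zetaR (d + 1))) * ∫ x in I, rho d x| ≤
      K1 d * Real.log H ^ lfun d / H := by
  have hH0 : (0:ℝ) < H := by exact_mod_cast (by omega : 0 < H)
  have hV := KL.Vol_eq d (by omega) I hI
  have h1 := KL.Nprim_bound d hd I hI H hH0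
  have h2 := KL.count_diff I hI d H hd
  have h3 := KL.card_Bad d H hd hH
  have hz := KL.one_le_zetaR (d+1) (by omega)
  have hK := (KL.const_le d hd).trans (KL.K1_ge d hd)
  rw [← hV]
  have hlog2 : (1/2:ℝ) ≤ Real.log 2 := by linarith [Real.log_two_gt_d9]
  have hlogH : Real.log 2 ≤ Real.log H := Real.log_le_log (by norm_num) (by exact_mod_cast hH)
  have hL : 1 ≤ 2 * Real.log H ^ lfun d := by
    unfold lfun
    split_ifs
    · rw [pow_one]; linarith
    · norm_num
  have hg : (if d = 2 then 12 * Real.log H else 2) ≤ 12 * Real.log H ^ lfun d := by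
    unfold lfun
    split_ifs
    · rw [pow_one]
    · norm_num
  set L := Real.log H ^ lfun d
  set g := (if d = 2 then 12 * Real.log H else 2)
  set n : ℝ := (Set.ncard (algSet d H ∩ I) : ℝ)
  set N := KL.Nprim I d H
  set V := KL.Vol I d
  set Z := zetaR (d+1)
  have hHd : (0:ℝ) < (H:ℝ) ^ d := by positivity
  have h4 : |2 * n - V / Z * (H:ℝ) ^ (d+1)| ≤ d * (KL.Bad d H).card + 4 * KL.C1 d * (H:ℝ) ^ d := by
    have := abs_add_le (2 * n - N) (N - V / Z * (H:ℝ) ^ (d+1))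
    rw [sub_add_sub_cancel] at this
    linarith
  have hC1 : 0 ≤ KL.C1 d := by unfold KL.C1; positivity
  have h5 : (d:ℝ) * (KL.Bad d H).card + 4 * KL.C1 d * (H:ℝ) ^ d ≤ 2 * K1 d * L * (H:ℝ) ^ d := by
    have b1 : (d:ℝ) * (KL.Bad d H).card ≤ d * ((3 * H) ^ d + d * (6 ^ (d+2) * ((2 ^ d * (d+1) * H) ^ d * g))) :=
      mul_le_mul_of_nonneg_left h3 (by positivity)
    have b2 : d * ((3 * (H:ℝ)) ^ d + d * (6 ^ (d+2) * ((2 ^ d * (d+1) * H) ^ d * g)))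
        = (d * 3 ^ d * 1 + d ^ 2 * (6 ^ (d+2) * (2 ^ d * (d+1)) ^ d) * g) * (H:ℝ) ^ d := by
      rw [mul_pow, mul_pow _ (H:ℝ)]; ring
    have b3 : (d:ℝ) * 3 ^ d * 1 ≤ d * 3 ^ d * (2 * L) := mul_le_mul_of_nonneg_left hL (by positivity)
    have b4 : (d:ℝ) ^ 2 * (6 ^ (d+2) * (2 ^ d * (d+1)) ^ d) * g ≤ d ^ 2 * (6 ^ (d+2) * (2 ^ d * (d+1)) ^ d) * (12 * L) :=
      mul_le_mul_of_nonneg_left hg (by positivity)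
    have b5 : 4 * KL.C1 d * 1 ≤ 4 * KL.C1 d * (2 * L) := mul_le_mul_of_nonneg_left hL (by positivity)
    have hL0 : 0 ≤ 2 * L := by linarith
    have b6 := mul_le_mul_of_nonneg_right hK hL0
    have b7 : d * 3 ^ d * 1 + d ^ 2 * (6 ^ (d+2) * (2 ^ d * (d+1)) ^ d) * g + 4 * KL.C1 d ≤ 2 * K1 d * L := by
      linarith
    have b8 := mul_le_mul_of_nonneg_right b7 hHd.le
    linarith
  have h6 : n / (H:ℝ) ^ (d+1) - 1 / (2 * Z) * V = (2 * n - V / Z * (H:ℝ) ^ (d+1)) / (2 * (H:ℝ) ^ (d+1)) := by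
    have : Z ≠ 0 := by linarith
    field_simp
  rw [h6, abs_div, abs_of_pos (by positivity : (0:ℝ) < 2 * (H:ℝ) ^ (d+1)), div_le_div_iff₀ (by positivity) hH0]
  have h7 := mul_le_mul_of_nonneg_right (h4.trans h5) hH0.le
  refine h7.trans (le_of_eq ?_)
  ring
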